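/- arXiv:1307.1353 — 2 statements merged into one kernel-verified Lean document; each statement's English description precedes it below -/
import Mathlib

section
/- Let 𝒢 be a class of finite simple graphs. (1) 𝒢 has bounded treewidth if and only if 𝒢 ≼ 𝒯. (2) 𝒢 has bounded pathwidth if and only if 𝒢 ≼ 𝒫. (3) 𝒢 has bounded tree depth if and only if there exists d ≥ 0 such that 𝒢 ≼ ℱ_d. -/
open SimpleGraph

/-- The reflexive closure of the adjacency relation of a graph. -/
def reflAdj {α : Type} (G : SimpleGraph α) (a b : α) : Prop := a = b ∨ G.Adj a b

/-- A set of vertices induces a connected subgraph of `G`. -/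
def ConnSet {α : Type} (G : SimpleGraph α) (s : Set α) : Prop := (G.induce s).Connected

/-- `B` is an `H`-deconstruction of `G`: coverage and connectivity. -/
def IsDeconstruction {α β : Type} (G : SimpleGraph α) (H : SimpleGraph β)
    (B : β → Set α) : Prop :=
  (∀ g g' : α, reflAdj G g g' →
      ∃ h h' : β, reflAdj H h h' ∧ g ∈ B h ∪ B h' ∧ g' ∈ B h ∪ B h') ∧
  (∀ g : α, ConnSet H {h | g ∈ B h})

/-- The family `B` (viewed as an `H`-indexed family of bags) has width at most `w`. -/
def DeconWidthLE {α β : Type} (H : SimpleGraph β) (B : β → Set α) (w : ℕ) : Prop :=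
  ∀ h h' : β, reflAdj H h h' → (B h ∪ B h').ncard ≤ w

/-- `B` is an `H`-decomposition of `G`: each (refl-)edge inside a single bag, plus
connectivity. -/
def IsDecomposition {α β : Type} (G : SimpleGraph α) (H : SimpleGraph β)
    (B : β → Set α) : Prop :=
  (∀ g g' : α, reflAdj G g g' → ∃ h : β, g ∈ B h ∧ g' ∈ B h) ∧
  (∀ g : α, ConnSet H {h | g ∈ B h})

/-- A finite simple graph, presented on a vertex set `Fin n`. -/
structure FinGraph where
  n : ℕ
  G : SimpleGraph (Fin n)

/-- `𝒢 ≼ ℋ` : every graph in `𝒢` has an `H`-deconstruction of width `≤ w`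
for some `H ∈ ℋ`, for a uniform constant `w`. -/
def DeconLE (𝒢 ℋ : Set FinGraph) : Prop :=
  ∃ w : ℕ, ∀ G ∈ 𝒢, ∃ H ∈ ℋ, ∃ B : Fin H.n → Set (Fin G.n),
    IsDeconstruction G.G H.G B ∧ DeconWidthLE H.G B w

/-- `𝒢 ≡ ℋ`. -/
def DeconEquiv (𝒢 ℋ : Set FinGraph) : Prop := DeconLE 𝒢 ℋ ∧ DeconLE ℋ 𝒢

/-- `𝒢 ≺ ℋ`. -/
def DeconLT (𝒢 ℋ : Set FinGraph) : Prop := DeconLE 𝒢 ℋ ∧ ¬ DeconEquiv 𝒢 ℋ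

/-- `μ` is a minor map from `M` to `G`. -/
def IsMinorMap {α β : Type} (M : SimpleGraph α) (G : SimpleGraph β)
    (μ : α → Set β) : Prop :=
  (∀ m : α, ConnSet G (μ m)) ∧
  (∀ m m' : α, m ≠ m' → Disjoint (μ m) (μ m')) ∧
  (∀ m m' : α, M.Adj m m' → ∃ g ∈ μ m, ∃ g' ∈ μ m', G.Adj g g')

/-- `M` is a minor of `G`. -/
def IsMinor (M G : FinGraph) : Prop :=
  ∃ μ : Fin M.n → Set (Fin G.n), IsMinorMap M.G G.G μ

/-- The class of all minors of graphs in `𝒢`. -/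
def minorsCl (𝒢 : Set FinGraph) : Set FinGraph := {M | ∃ G ∈ 𝒢, IsMinor M G}

/-- The (connected) graph `G`, viewed as a tree, has height at most `d`:
some rooting puts every vertex within distance `d` of the root. -/
def treeHeightLE (G : FinGraph) (d : ℕ) : Prop :=
  ∃ r : Fin G.n, ∀ v : Fin G.n, G.G.dist r v ≤ d

/-- Every connected component of `G` has height at most `d`. -/
def forestHeightLE (G : FinGraph) (d : ℕ) : Prop :=
  ∀ v : Fin G.n, ∃ r : Fin G.n, G.G.Reachable r v ∧
    ∀ u : Fin G.n, G.G.Reachable r u → G.G.dist r u ≤ d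

/-- `ℒ` : the class of all finite simple graphs. -/
def classL : Set FinGraph := Set.univ

/-- `𝒯` : the class of all finite trees. -/
def classT : Set FinGraph := {G | G.G.IsTree}

/-- `𝒫` : the class of all finite paths (on at least two vertices). -/
def classP : Set FinGraph := {G | ∃ m : ℕ, 2 ≤ m ∧ Nonempty (G.G ≃g pathGraph m)}

/-- `𝒯_d` : all finite trees of height at most `d`. -/
def classTd (d : ℕ) : Set FinGraph := {G | G.G.IsTree ∧ treeHeightLE G d}

/-- `ℱ_d` : all finite forests of height at most `d`. -/
def classFd (d : ℕ) : Set FinGraph := {G | G.G.IsAcyclic ∧ forestHeightLE G d}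

/-- The complete `k`-ary tree `T_{h,k}` of height `h`, on strings over `[k]` of
length at most `h`; each string of length `< h` is joined to its one-symbol extensions. -/
def kAryTree (h k : ℕ) : SimpleGraph {l : List (Fin k) // l.length ≤ h} :=
  SimpleGraph.fromRel (fun a b => ∃ i : Fin k, b.1 = i :: a.1)

/-- For every `k ≥ 1`, the tree `T_{h,k}` is a minor of some graph in `𝒢`. -/
def StackAll (𝒢 : Set FinGraph) (h : ℕ) : Prop :=
  ∀ k : ℕ, 1 ≤ k → ∃ G ∈ 𝒢, ∃ μ : {l : List (Fin k) // l.length ≤ h} → Set (Fin G.n),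
    IsMinorMap (kAryTree h k) G.G μ

/-- `𝒢` has stack depth (exactly) `d`. -/
def HasStackDepth (𝒢 : Set FinGraph) (d : ℕ) : Prop :=
  StackAll 𝒢 d ∧ ¬ StackAll 𝒢 (d + 1)

/-- The tree depth of `G` is at most `h`: there is a rooted forest on the vertex
set of `G` (given by a parent function whose fixed points are the roots) of height
at most `h` whose (ancestor-descendant) closure contains all edges of `G`. -/
def TreeDepthLE {α : Type} (G : SimpleGraph α) (h : ℕ) : Prop :=
  ∃ par : α → α,
    (∀ v : α, par (par^[h] v) = par^[h] v) ∧
    (∀ u v : α, G.Adj u v → (∃ k : ℕ, par^[k] u = v) ∨ (∃ k : ℕ, par^[k] v = u))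

/-- The class `𝒢` has bounded tree depth. -/
def HasBoundedTreeDepth (𝒢 : Set FinGraph) : Prop :=
  ∃ h : ℕ, ∀ G ∈ 𝒢, TreeDepthLE G.G h

/-- The class `𝒢` has bounded treewidth (via tree decompositions). -/
def HasBoundedTreewidth (𝒢 : Set FinGraph) : Prop :=
  ∃ w : ℕ, ∀ G ∈ 𝒢, ∃ H : FinGraph, H.G.IsTree ∧
    ∃ B : Fin H.n → Set (Fin G.n), IsDecomposition G.G H.G B ∧ ∀ h, (B h).ncard ≤ w + 1

/-- The class `𝒢` has bounded pathwidth (via path decompositions). -/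
def HasBoundedPathwidth (𝒢 : Set FinGraph) : Prop :=
  ∃ w : ℕ, ∀ G ∈ 𝒢, ∃ H : FinGraph, H ∈ classP ∧
    ∃ B : Fin H.n → Set (Fin G.n), IsDecomposition G.G H.G B ∧ ∀ h, (B h).ncard ≤ w + 1

/-- A finite rooted tree. -/
structure RootedFinTree where
  n : ℕ
  G : SimpleGraph (Fin n)
  isTree : G.IsTree
  root : Fin n

/-- `c` is a child of `p` in the rooted tree `T`. -/
def RootedFinTree.IsChild (T : RootedFinTree) (p c : Fin T.n) : Prop :=
  T.G.Adj p c ∧ T.G.dist T.root c = T.G.dist T.root p + 1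

/-- `a` is an ancestor of `v` in the rooted tree `T` (i.e. `a` lies on the unique
path from the root to `v`). -/
def RootedFinTree.Ancestor (T : RootedFinTree) (a v : Fin T.n) : Prop :=
  T.G.dist T.root v = T.G.dist T.root a + T.G.dist a v

/-- `(μ m)_{m}` is a nice `M`-deconstruction of `G`, for rooted trees `M`, `G`. -/
def IsNiceDecon (M G : RootedFinTree) (μ : Fin M.n → Set (Fin G.n)) : Prop :=
  IsDeconstruction G.G M.G μ ∧
  IsMinorMap M.G G.G μ ∧
  G.root ∈ μ M.root ∧
  (∀ (m m' : Fin M.n) (g g' : Fin G.n),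
    M.IsChild m m' → g ∈ μ m → g' ∈ μ m' → G.G.Adj g g' → G.IsChild g g')

/-- The node `u` of the rooted tree `T` has property `P(d,k)`. -/
def PropP (T : RootedFinTree) (k : ℕ) : ℕ → Fin T.n → Prop
  | 0, _ => True
  | d + 1, u => ∃ s : Finset (Fin T.n), s.card = k ∧
      (∀ v ∈ s, T.Ancestor u v) ∧
      (∀ v ∈ s, ∀ w ∈ s, v ≠ w → ¬ T.Ancestor v w ∧ ¬ T.Ancestor w v) ∧
      (∀ v ∈ s, PropP T k d v)

/-- Every acyclic graph with a choice of roots has a parent function. -/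
theorem exists_parent {V : Type} (H : SimpleGraph V) (hac : H.IsAcyclic) (ρ : V → V)
    (hρ : ∀ v, H.Reachable (ρ v) v) (hc : ∀ u v, H.Adj u v → ρ u = ρ v) :
    ∃ p : V → V, (∀ h, reflAdj H h (p h)) ∧ (∀ h h', H.Adj h h' → p h = h' ∨ p h' = h) ∧
      (∀ h, p h ≠ h → H.dist (ρ (p h)) (p h) < H.dist (ρ h) h) := by
  classical
  have ex : ∀ r h, H.Reachable r h → ∃ w : H.Walk r h, w.IsPath ∧ w.length = H.dist r h :=
    fun r h hr => hr.exists_path_of_dist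
  choose P hP hl using ex
  let p : V → V := fun h => (P (ρ h) h (hρ h)).penultimate
  have hp : ∀ h r (_ : ρ h = r) (hr : H.Reachable r h), p h = (P r h hr).penultimate := by
    intro h r e hr
    subst e
    rfl
  refine ⟨p, ?_, ?_, ?_⟩
  · intro h
    by_cases hn : (P (ρ h) h (hρ h)).Nil
    · left
      have := hn.eq
      have h2 : (P (ρ h) h (hρ h)).length = 0 := Walk.length_eq_zero_iff.mpr hn
      show h = (P (ρ h) h (hρ h)).penultimate
      unfold Walk.penultimate
      rw [h2]
      simp [this]
    · right
      exact ((P (ρ h) h (hρ h)).adj_penultimate hn).symm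
  · intro h h' hadj
    have e := hc h h' hadj
    have hr' : H.Reachable (ρ h) h' := (hρ h).trans hadj.reachable
    rw [hp h (ρ h) rfl (hρ h), hp h' (ρ h) e.symm hr']
    by_cases hm : h ∈ (P (ρ h) h' hr').support
    · right
      have := hac.path_concat (hP _ _ (hρ h)) (hP _ _ hr') hadj hm
      rw [this]
      simp
    · left
      have hm' := hac.mem_support_of_ne_mem_support_of_adj_of_isPath (hP _ _ (hρ h)) (hP _ _ hr')
        hadj hm
      have := hac.path_concat (hP _ _ hr') (hP _ _ (hρ h)) hadj.symm hm'
      rw [this]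
      simp
  · intro h hne
    have hn : ¬ (P (ρ h) h (hρ h)).Nil := by
      intro hn
      apply hne
      have := hn.eq
      have h2 : (P (ρ h) h (hρ h)).length = 0 := Walk.length_eq_zero_iff.mpr hn
      show (P (ρ h) h (hρ h)).penultimate = h
      unfold Walk.penultimate
      rw [h2]
      simp [this]
    have hadj : H.Adj (p h) h := (P (ρ h) h (hρ h)).adj_penultimate hn
    rw [hc _ _ hadj]
    have hr' : H.Reachable (ρ h) (p h) := (hρ h).trans hadj.symm.reachable
    have hm : p h ∈ (P (ρ h) h (hρ h)).support := Walk.getVert_mem_support _ _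
    have := hac.path_concat (hP _ _ hr') (hP _ _ (hρ h)) hadj hm
    rw [← hl _ _ (hρ h), ← hl _ _ hr', this]
    simp

/-- Merging each bag with the parent bag turns a deconstruction into a decomposition. -/
theorem decon_to_decomp {α β : Type} [Finite α] (G : SimpleGraph α) (H : SimpleGraph β)
    (B : β → Set α)
    (p : β → β) (hp : ∀ h, reflAdj H h (p h)) (hp2 : ∀ h h', H.Adj h h' → p h = h' ∨ p h' = h)
    (w : ℕ) (hB : IsDeconstruction G H B) (hw : DeconWidthLE H B w) :
    ∃ B' : β → Set α, IsDecomposition G H B' ∧ ∀ h, (B' h).ncard ≤ w := by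
  refine ⟨fun h => B h ∪ B (p h), ⟨?_, ?_⟩, fun h => hw _ _ (hp h)⟩
  · intro g g' hg
    obtain ⟨h, h', hh, h1, h2⟩ := hB.1 g g' hg
    rcases hh with rfl | hh
    · rw [Set.union_self] at h1 h2
      exact ⟨h, Or.inl h1, Or.inl h2⟩
    · rcases hp2 h h' hh with rfl | rfl
      · exact ⟨h, h1, h2⟩
      · exact ⟨h', by rwa [Set.union_comm] at h1, by rwa [Set.union_comm] at h2⟩
  · intro g
    have hS := hB.2 g
    unfold ConnSet at hS ⊢
    obtain ⟨⟨s, hs⟩⟩ := hS.nonempty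
    rw [connected_iff_exists_forall_reachable]
    have hsub : {h | g ∈ B h} ⊆ {h | g ∈ B h ∪ B (p h)} := fun h hh => Or.inl hh
    have key : ∀ x (hx : x ∈ {h | g ∈ B h}), (H.induce {h | g ∈ B h ∪ B (p h)}).Reachable
        ⟨s, hsub hs⟩ ⟨x, hsub hx⟩ := by
      intro x hx
      exact (hS.preconnected ⟨s, hs⟩ ⟨x, hx⟩).map (induceHomOfLE H hsub).toHom
    refine ⟨⟨s, hsub hs⟩, ?_⟩
    rintro ⟨x, hx⟩
    rcases hx with hx | hx
    · exact key x hx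
    · refine (key (p x) hx).trans ?_
      rcases hp x with e | e
      · have : (⟨p x, hsub hx⟩ : {h | g ∈ B h ∪ B (p h)}) = ⟨x, Or.inr hx⟩ := Subtype.ext e.symm
        rw [this]
      · apply Adj.reachable
        simpa using e.symm

theorem decomp_to_decon {α β : Type} [Finite α] (G : SimpleGraph α) (H : SimpleGraph β)
    (B : β → Set α) (w : ℕ) (hB : IsDecomposition G H B) (hw : ∀ h, (B h).ncard ≤ w) :
    IsDeconstruction G H B ∧ DeconWidthLE H B (w + w) := by
  refine ⟨⟨?_, hB.2⟩, ?_⟩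
  · intro g g' hg
    obtain ⟨h, h1, h2⟩ := hB.1 g g' hg
    exact ⟨h, h, Or.inl rfl, Or.inl h1, Or.inl h2⟩
  · intro h₁ h₂ _
    exact (Set.ncard_union_le _ _).trans (add_le_add (hw h₁) (hw h₂))

/-- From a tree-like strict order with small down-sets to a bound on tree depth. -/
theorem treeDepth_of_order {α : Type} [Finite α] (G : SimpleGraph α) (R : α → α → Prop)
    (hirr : ∀ a, ¬ R a a) (htr : ∀ a b c, R a b → R b c → R a c)
    (hlin : ∀ a b c, R a c → R b c → a = b ∨ R a b ∨ R b a)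
    (N : ℕ) (hN : ∀ v, {a | R a v}.ncard ≤ N)
    (hE : ∀ u v, G.Adj u v → R u v ∨ R v u) : TreeDepthLE G N := by
  classical
  have ex : ∀ v, ∃ q, (q = v ∧ ∀ a, ¬ R a v) ∨ (R q v ∧ ∀ a, R a v → a = q ∨ R a q) := by
    intro v
    by_cases hv : ∃ a, R a v
    · obtain ⟨q, hq, hm⟩ := Set.exists_max_image {a | R a v} (fun a => {b | R b a}.ncard)
        (Set.toFinite _) hv
      refine ⟨q, Or.inr ⟨hq, fun a ha => ?_⟩⟩
      rcases hlin a q v ha hq with h | h | h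
      · exact Or.inl h
      · exact Or.inr h
      · exfalso
        have h1 := hm a ha
        have h2 : {b | R b q}.ncard < {b | R b a}.ncard := by
          apply Set.ncard_lt_ncard _ (Set.toFinite _)
          refine ⟨fun b hb => htr _ _ _ hb h, fun hh => hirr q (hh h)⟩
        omega
    · exact ⟨v, Or.inl ⟨rfl, fun a ha => hv ⟨a, ha⟩⟩⟩
  choose par hpar using ex
  have hdec : ∀ v, par v ≠ v → {a | R a (par v)}.ncard < {a | R a v}.ncard := by
    intro v hv
    rcases hpar v with h | h
    · exact absurd h.1 hv
    · apply Set.ncard_lt_ncard _ (Set.toFinite _)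
      exact ⟨fun b hb => htr _ _ _ hb h.1, fun hh => hirr (par v) (hh h.1)⟩
  refine ⟨par, ?_, ?_⟩
  · have : ∀ n v, {a | R a v}.ncard ≤ n → par (par^[n] v) = par^[n] v := by
      intro n
      induction n with
      | zero =>
        intro v hv
        by_contra hne
        have := hdec v hne
        omega
      | succ n ih =>
        intro v hv
        rw [Function.iterate_succ_apply]
        by_cases hne : par v = v
        · rw [hne]
          have : ∀ k, par^[k] v = v := fun k => Function.iterate_fixed hne k
          rw [this, hne]
        · have := hdec v hne
          exact ih _ (by omega)
    exact fun v => this N v (hN v)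
  · have : ∀ n v a, {a | R a v}.ncard ≤ n → R a v → ∃ k, par^[k] v = a := by
      intro n
      induction n with
      | zero =>
        intro v a hv ha
        have : {a | R a v} = ∅ := by
          rw [← Set.ncard_eq_zero (Set.toFinite _)]
          omega
        have h3 : a ∈ {a | R a v} := ha
        rw [this] at h3
        exact h3.elim
      | succ n ih =>
        intro v a hv ha
        rcases hpar v with h | h
        · exact (h.2 a ha).elim
        · rcases h.2 a ha with e | e
          · exact ⟨1, e.symm⟩
          · have := hdec v (fun e => hirr v (by have := h.1; rwa [e] at this))
            obtain ⟨k, hk⟩ := ih (par v) a (by omega) e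
            exact ⟨k + 1, hk⟩
    intro u v huv
    rcases hE u v huv with h | h
    · exact Or.inr (this N v u (hN v) h)
    · exact Or.inl (this N u v (hN u) h)

/-- A deconstruction over a bounded-height rooted forest bounds the tree depth. -/
theorem treeDepth_of_decon {n : ℕ} {β : Type} [Finite β] (G : SimpleGraph (Fin n))
    (H : SimpleGraph β) (B : β → Set (Fin n)) (p : β → β) (δ : β → ℕ) (d w : ℕ)
    (hp2 : ∀ h h', H.Adj h h' → p h = h' ∨ p h' = h)
    (hδ : ∀ h, p h ≠ h → δ (p h) < δ h) (hd : ∀ h, δ h ≤ d)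
    (hB : IsDeconstruction G H B) (hw : DeconWidthLE H B w) :
    TreeDepthLE G ((d + 1) * w) := by
  classical
  let Anc : β → β → Prop := fun a b => ∃ k, p^[k] b = a
  have anc_refl : ∀ a, Anc a a := fun a => ⟨0, rfl⟩
  have anc_trans : ∀ a b c, Anc a b → Anc b c → Anc a c := by
    rintro a b c ⟨k, rfl⟩ ⟨l, rfl⟩
    exact ⟨k + l, Function.iterate_add_apply p k l c⟩
  have anc_par : ∀ a, Anc (p a) a := fun a => ⟨1, rfl⟩
  have anc_lin : ∀ a b c, Anc a c → Anc b c → Anc a b ∨ Anc b a := by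
    rintro a b c ⟨k, rfl⟩ ⟨l, rfl⟩
    rcases le_total k l with h | h
    · right
      refine ⟨l - k, ?_⟩
      rw [← Function.iterate_add_apply]
      congr 1
      omega
    · left
      refine ⟨k - l, ?_⟩
      rw [← Function.iterate_add_apply]
      congr 1
      omega
  have anc_δ : ∀ a b, Anc a b → a = b ∨ δ a < δ b := by
    rintro a b ⟨k, rfl⟩
    induction k with
    | zero => exact Or.inl rfl
    | succ k ih =>
      rw [Function.iterate_succ_apply']
      by_cases hk : p (p^[k] b) = p^[k] b
      · rw [hk]; exact ih
      · have := hδ _ hk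
        rcases ih with e | e
        · right
          rw [e] at this ⊢
          exact this
        · right; omega
  have anc_antisymm : ∀ a b, Anc a b → Anc b a → a = b := by
    intro a b h1 h2
    rcases anc_δ a b h1 with e | e
    · exact e
    · rcases anc_δ b a h2 with e' | e'
      · exact e'.symm
      · omega
  have anc_card : ∀ b, {a | Anc a b}.ncard ≤ d + 1 := by
    intro b
    have : {a | Anc a b}.ncard ≤ (Finset.range (d + 1) : Set ℕ).ncard := by
      apply Set.ncard_le_ncard_of_injOn δ
      · intro a _
        have := hd a
        simp
        omega
      · intro a ha a' ha' e
        rcases anc_lin a a' b ha ha' with h | h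
        · rcases anc_δ _ _ h with h | h
          · exact h
          · omega
        · rcases anc_δ _ _ h with h | h
          · exact h.symm
          · omega
    rwa [Set.ncard_coe_finset, Finset.card_range] at this
  -- top nodes
  have ex : ∀ g, ∃ t, g ∈ B t ∧ ∀ x, g ∈ B x → Anc t x := by
    intro g
    have hS := hB.2 g
    unfold ConnSet at hS
    obtain ⟨⟨s, hs⟩⟩ := hS.nonempty
    obtain ⟨t, ht, hm⟩ := Set.exists_min_image {h | g ∈ B h} δ (Set.toFinite _) ⟨s, hs⟩
    refine ⟨t, ht, fun x hx => ?_⟩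
    obtain ⟨W⟩ := hS.preconnected ⟨x, hx⟩ ⟨t, ht⟩
    have key : ∀ (a b : {h | g ∈ B h}) (_ : (H.induce {h | g ∈ B h}).Walk a b),
        b.1 = t → Anc t a.1 := by
      intro a b W
      induction W with
      | nil => intro e; rw [e]; exact anc_refl t
      | @cons u v w hadj q ih =>
        intro e
        have hv := ih e
        have hadj' : H.Adj u.1 v.1 := by simpa using hadj
        rcases hp2 _ _ hadj' with h | h
        · rw [← h] at hv
          exact anc_trans _ _ _ hv (anc_par _)
        · obtain ⟨k, hk⟩ := hv
          cases k with
          | zero =>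
            exfalso
            have hk' : v.1 = t := hk
            have h1 : δ (p v.1) < δ v.1 := hδ v.1 (by rw [h]; exact hadj'.ne)
            rw [h, hk'] at h1
            have := hm u.1 u.2
            omega
          | succ k =>
            rw [Function.iterate_succ_apply, h] at hk
            exact ⟨k, hk⟩
    exact key _ _ W rfl
  choose t ht hta using ex
  let R : Fin n → Fin n → Prop := fun a v => (t a ≠ t v ∧ Anc (t a) (t v)) ∨ (t a = t v ∧ a < v)
  have comp : ∀ a b, Anc (t a) (t b) ∨ Anc (t b) (t a) → a = b ∨ R a b ∨ R b a := by
    intro a b h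
    by_cases e : t a = t b
    · rcases lt_trichotomy a b with h | h | h
      · exact Or.inr (Or.inl (Or.inr ⟨e, h⟩))
      · exact Or.inl h
      · exact Or.inr (Or.inr (Or.inr ⟨e.symm, h⟩))
    · rcases h with h | h
      · exact Or.inr (Or.inl (Or.inl ⟨e, h⟩))
      · exact Or.inr (Or.inr (Or.inl ⟨Ne.symm e, h⟩))
  have R_anc : ∀ a b, R a b → Anc (t a) (t b) := by
    rintro a b (h | h)
    · exact h.2
    · rw [h.1]; exact anc_refl _
  apply treeDepth_of_order G R
  · rintro a (h | h)
    · exact h.1 rfl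
    · exact lt_irrefl _ h.2
  · intro a b c hab hbc
    have h1 := R_anc _ _ hab
    have h2 := R_anc _ _ hbc
    by_cases e : t a = t c
    · right
      refine ⟨e, ?_⟩
      have e2 : t b = t c := anc_antisymm _ _ h2 (by rw [← e]; exact h1)
      rcases hab with h | h
      · exact (h.1 (e.trans e2.symm)).elim
      · rcases hbc with h' | h'
        · exact (h'.1 e2).elim
        · exact h.2.trans h'.2
    · exact Or.inl ⟨e, anc_trans _ _ _ h1 h2⟩
  · intro a b c ha hb
    exact comp a b (anc_lin _ _ _ (R_anc _ _ ha) (R_anc _ _ hb))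
  · intro v
    have hfin : {a | Anc a (t v)}.Finite := Set.toFinite _
    have hsub : {a | R a v} ⊆
        ((hfin.toFinset.biUnion fun s => (B s).toFinite.toFinset : Finset (Fin n)) :
          Set (Fin n)) := by
      intro a ha
      simp only [Finset.coe_biUnion, Set.mem_iUnion]
      exact ⟨t a, by simpa using R_anc _ _ ha, by simpa using ht a⟩
    refine (Set.ncard_le_ncard hsub (Set.toFinite _)).trans ?_
    rw [Set.ncard_coe_finset]
    refine (Finset.card_biUnion_le_card_mul _ _ w ?_).trans ?_
    · intro s _
      have := hw s s (Or.inl rfl)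
      rw [Set.union_self] at this
      rwa [← Set.ncard_eq_toFinset_card]
    · apply Nat.mul_le_mul_right
      rw [← Set.ncard_eq_toFinset_card]
      exact anc_card _
  · intro u v huv
    have hne := huv.ne
    have : ∃ x, Anc (t u) x ∧ Anc (t v) x := by
      obtain ⟨h, h', hh, h1, h2⟩ := hB.1 u v (Or.inr huv)
      have cover : ∀ h h', (h = h' ∨ p h = h') → ∀ g, g ∈ B h ∪ B h' → Anc (t g) h := by
        intro h h' hh g hg
        rcases hg with hg | hg
        · exact hta g h hg
        · rcases hh with rfl | rfl
          · exact hta g _ hg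
          · exact anc_trans _ _ _ (hta g _ hg) (anc_par _)
      have : (h = h' ∨ p h = h') ∨ (h' = h ∨ p h' = h) := by
        rcases hh with rfl | hh
        · exact Or.inl (Or.inl rfl)
        · rcases hp2 _ _ hh with e | e
          · exact Or.inl (Or.inr e)
          · exact Or.inr (Or.inr e)
      rcases this with hc | hc
      · exact ⟨h, cover h h' hc u h1, cover h h' hc v h2⟩
      · rw [Set.union_comm] at h1 h2
        exact ⟨h', cover h' h hc u h1, cover h' h hc v h2⟩
    obtain ⟨x, hx1, hx2⟩ := this
    rcases comp u v (anc_lin _ _ _ hx1 hx2) with e | e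
    · exact (hne e).elim
    · exact e

/-- Bounded tree depth gives deconstructions over forests of bounded height. -/
theorem decon_of_treeDepth (G : FinGraph) (d : ℕ) (hG : TreeDepthLE G.G d) :
    ∃ H ∈ classFd d, ∃ B : Fin H.n → Set (Fin G.n),
      IsDeconstruction G.G H.G B ∧ DeconWidthLE H.G B ((d + 1) + (d + 1)) := by
  classical
  obtain ⟨par, hroot, hE⟩ := hG
  let H : SimpleGraph (Fin G.n) := SimpleGraph.fromRel (fun a b => par a = b)
  have hadj : ∀ a b, H.Adj a b ↔ a ≠ b ∧ (par a = b ∨ par b = a) := by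
    intro a b
    exact SimpleGraph.fromRel_adj _ _ _
  have hfix : ∀ v k, d ≤ k → par^[k] v = par^[d] v := by
    intro v k hk
    obtain ⟨j, rfl⟩ := Nat.exists_eq_add_of_le hk
    rw [add_comm, Function.iterate_add_apply]
    exact Function.iterate_fixed (hroot v) j
  have hnocyc : ∀ v k, par^[k + 1] v = v → par v = v := by
    intro v k hk
    have h1 : (par^[k + 1])^[d] v = v := Function.iterate_fixed hk d
    rw [← Function.iterate_mul, hfix v _ (by nlinarith)] at h1
    have := hroot v
    rwa [h1] at this
  have hwalk : ∀ k v, ∃ W : H.Walk v (par^[k] v), W.length ≤ k := by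
    intro k
    induction k with
    | zero => exact fun v => ⟨Walk.nil, by simp⟩
    | succ k ih =>
      intro v
      rw [Function.iterate_succ_apply]
      obtain ⟨W, hW⟩ := ih (par v)
      by_cases e : par v = v
      · rw [e]
        obtain ⟨W', hW'⟩ := ih v
        exact ⟨W', by omega⟩
      · exact ⟨Walk.cons ((hadj _ _).2 ⟨fun h => e h.symm, Or.inl rfl⟩) W, by simpa using hW⟩
  refine ⟨⟨G.n, H⟩, ⟨?_, ?_⟩, fun x => {a | ∃ k, par^[k] x = a}, ⟨?_, ?_⟩, ?_⟩
  · show H.IsAcyclic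
    rw [isAcyclic_iff_forall_adj_isBridge]
    have main : ∀ v, par v ≠ v → ¬ (H.deleteEdges {s(v, par v)}).Reachable v (par v) := by
      rintro v hv ⟨W⟩
      have key : ∀ a b (_ : (H.deleteEdges {s(v, par v)}).Walk a b),
          (∃ k, par^[k] a = v) → ∃ k, par^[k] b = v := by
        intro a b W
        induction W with
        | nil => exact id
        | @cons x y z hxy q ih =>
          rintro ⟨k, hk⟩
          apply ih
          rw [deleteEdges_adj, hadj] at hxy
          obtain ⟨⟨hne, h | h⟩, hn⟩ := hxy
          · cases k with
            | zero =>
              exfalso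
              have hk' : x = v := hk
              apply hn
              rw [← h, hk']
              rfl
            | succ k =>
              rw [Function.iterate_succ_apply, h] at hk
              exact ⟨k, hk⟩
          · exact ⟨k + 1, by rw [Function.iterate_succ_apply, h, hk]⟩
      obtain ⟨k, hk⟩ := key _ _ W ⟨0, rfl⟩
      exact hv (hnocyc v k (by rwa [Function.iterate_succ_apply]))
    intro v w hvw
    obtain ⟨hne, h | h⟩ := (hadj v w).1 hvw
    · subst h
      exact isBridge_iff.2 (main v hne.symm)
    · subst h
      rw [Sym2.eq_swap]
      exact isBridge_iff.2 (main w hne)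
  · intro v
    change Fin G.n at v
    refine ⟨(par^[d] v : Fin G.n), ?_, ?_⟩
    · obtain ⟨W, _⟩ := hwalk d v
      exact ⟨W.reverse⟩
    · intro u hu
      change Fin G.n at u
      change H.Reachable (par^[d] v) u at hu
      change H.dist (par^[d] v) u ≤ d
      have key : ∀ a b (_ : H.Walk a b), par^[d] a = par^[d] b := by
        intro a b W
        induction W with
        | nil => rfl
        | @cons x y z hxy q ih =>
          rw [← ih]
          have hh : ∀ x, par^[d] (par x) = par^[d] x := by
            intro x
            rw [← Function.iterate_succ_apply]
            exact hfix x (d + 1) (by omega)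
          obtain ⟨_, h | h⟩ := (hadj _ _).1 hxy
          · rw [← h, hh]
          · rw [← h, hh]
      obtain ⟨W⟩ := hu
      have e := key _ _ W
      rw [← Function.iterate_add_apply, hfix v _ (by omega)] at e
      rw [e]
      obtain ⟨W', hW'⟩ := hwalk d u
      rw [SimpleGraph.dist_comm]
      exact (dist_le W').trans hW'
  · intro g g' hg
    rcases hg with rfl | hg
    · exact ⟨g, g, Or.inl rfl, Or.inl ⟨0, rfl⟩, Or.inl ⟨0, rfl⟩⟩
    · rcases hE g g' hg with h | h
      · exact ⟨g, g, Or.inl rfl, Or.inl ⟨0, rfl⟩, Or.inl h⟩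
      · exact ⟨g', g', Or.inl rfl, Or.inl h, Or.inl ⟨0, rfl⟩⟩
  · intro g
    show (H.induce {x | ∃ k, par^[k] x = g}).Connected
    rw [connected_iff_exists_forall_reachable]
    refine ⟨⟨g, 0, rfl⟩, ?_⟩
    rintro ⟨x, k, hk⟩
    induction k generalizing x with
    | zero =>
      have : x = g := hk
      subst this
      rfl
    | succ k ih =>
      have hk' : par^[k] (par x) = g := hk
      refine (ih (par x) hk').trans ?_
      by_cases e : par x = x
      · have : (⟨par x, k, hk'⟩ : {x | ∃ k, par^[k] x = g}) = ⟨x, k + 1, hk⟩ := Subtype.ext e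
        rw [this]
      · apply Adj.reachable
        show H.Adj (par x) x
        exact (hadj _ _).2 ⟨e, Or.inr rfl⟩
  · have hb : ∀ x, {a | ∃ k, par^[k] x = a}.ncard ≤ d + 1 := by
      intro x
      have hs : {a | ∃ k, par^[k] x = a} ⊆
          (((Finset.range (d + 1)).image fun k => par^[k] x : Finset (Fin G.n)) :
            Set (Fin G.n)) := by
        rintro a ⟨k, rfl⟩
        rw [Finset.mem_coe, Finset.mem_image]
        rcases le_total k d with h | h
        · exact ⟨k, by simp; omega, rfl⟩
        · exact ⟨d, by simp, (hfix x k h).symm⟩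
      refine (Set.ncard_le_ncard hs (Set.toFinite _)).trans ?_
      rw [Set.ncard_coe_finset]
      exact Finset.card_image_le.trans (by simp)
    intro h h' _
    exact (Set.ncard_union_le _ _).trans (add_le_add (hb h) (hb h'))

theorem tree_parent (H : FinGraph) (hH : H.G.IsTree) :
    ∃ p : Fin H.n → Fin H.n, (∀ h, reflAdj H.G h (p h)) ∧
      (∀ h h', H.G.Adj h h' → p h = h' ∨ p h' = h) := by
  obtain ⟨r⟩ := hH.connected.nonempty
  obtain ⟨p, h1, h2, _⟩ := exists_parent H.G hH.isAcyclic (fun _ => r)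
    (fun v => hH.connected.preconnected r v) (fun _ _ _ => rfl)
  exact ⟨p, h1, h2⟩

theorem path_parent (H : FinGraph) (hH : H ∈ classP) :
    ∃ p : Fin H.n → Fin H.n, (∀ h, reflAdj H.G h (p h)) ∧
      (∀ h h', H.G.Adj h h' → p h = h' ∨ p h' = h) := by
  obtain ⟨m, hm, ⟨e⟩⟩ := hH
  let q : Fin m → Fin m := fun i => ⟨i.1 - 1, by omega⟩
  refine ⟨fun h => e.symm (q (e h)), ?_, ?_⟩
  · intro h
    by_cases h0 : (e h).1 = 0
    · left
      have : q (e h) = e h := Fin.ext (by simp only [q]; omega)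
      beta_reduce; rw [this]
      simp
    · right
      rw [← e.map_adj_iff, pathGraph_adj]
      right
      simp only [RelIso.apply_symm_apply, q]
      omega
  · intro h h' hadj
    rw [← e.map_adj_iff, pathGraph_adj] at hadj
    rcases hadj with hh | hh
    · right
      have : q (e h') = e h := Fin.ext (by simp only [q]; omega)
      beta_reduce; rw [this]
      simp
    · left
      have : q (e h) = e h' := Fin.ext (by simp only [q]; omega)
      beta_reduce; rw [this]
      simp

/-- (1) `𝒢` has bounded treewidth iff `𝒢 ≼ 𝒯`;
(2) `𝒢` has bounded pathwidth iff `𝒢 ≼ 𝒫`;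
(3) `𝒢` has bounded tree depth iff `𝒢 ≼ ℱ_d` for some `d ≥ 0`. -/
theorem bounded_characterizations (𝒢 : Set FinGraph) :
    (HasBoundedTreewidth 𝒢 ↔ DeconLE 𝒢 classT) ∧
    (HasBoundedPathwidth 𝒢 ↔ DeconLE 𝒢 classP) ∧
    (HasBoundedTreeDepth 𝒢 ↔ ∃ d : ℕ, DeconLE 𝒢 (classFd d)) := by
  refine ⟨⟨?_, ?_⟩, ⟨?_, ?_⟩, ⟨?_, ?_⟩⟩
  · rintro ⟨w, hw⟩
    refine ⟨(w + 1) + (w + 1), fun G hG => ?_⟩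
    obtain ⟨H, hH, B, hB, hBw⟩ := hw G hG
    exact ⟨H, hH, B, decomp_to_decon _ _ _ _ hB hBw⟩
  · rintro ⟨w, hw⟩
    refine ⟨w, fun G hG => ?_⟩
    obtain ⟨H, hH, B, hB, hBw⟩ := hw G hG
    obtain ⟨p, hp1, hp2⟩ := tree_parent H hH
    obtain ⟨B', hB', hw'⟩ := decon_to_decomp _ _ _ p hp1 hp2 w hB hBw
    exact ⟨H, hH, B', hB', fun h => (hw' h).trans (Nat.le_succ w)⟩
  · rintro ⟨w, hw⟩
    refine ⟨(w + 1) + (w + 1), fun G hG => ?_⟩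
    obtain ⟨H, hH, B, hB, hBw⟩ := hw G hG
    exact ⟨H, hH, B, decomp_to_decon _ _ _ _ hB hBw⟩
  · rintro ⟨w, hw⟩
    refine ⟨w, fun G hG => ?_⟩
    obtain ⟨H, hH, B, hB, hBw⟩ := hw G hG
    obtain ⟨p, hp1, hp2⟩ := path_parent H hH
    obtain ⟨B', hB', hw'⟩ := decon_to_decomp _ _ _ p hp1 hp2 w hB hBw
    exact ⟨H, hH, B', hB', fun h => (hw' h).trans (Nat.le_succ w)⟩
  · rintro ⟨d, hd⟩
    exact ⟨d, (d + 1) + (d + 1), fun G hG => decon_of_treeDepth G d (hd G hG)⟩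
  · rintro ⟨d, w, hw⟩
    refine ⟨(d + 1) * w, fun G hG => ?_⟩
    obtain ⟨H, ⟨hac, hht⟩, B, hB, hBw⟩ := hw G hG
    choose rt hrt hrd using hht
    let ρ : Fin H.n → Fin H.n := fun v => rt (H.G.connectedComponentMk v).out
    have hout : ∀ v, H.G.Reachable (H.G.connectedComponentMk v).out v := fun v =>
      ConnectedComponent.exact (Quot.out_eq _)
    have hρ : ∀ v, H.G.Reachable (ρ v) v := fun v => (hrt _).trans (hout v)
    obtain ⟨p, _, hp2, hp3⟩ := exists_parent H.G hac ρ hρ (by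
      intro u v huv
      have : H.G.connectedComponentMk u = H.G.connectedComponentMk v :=
        ConnectedComponent.sound huv.reachable
      simp only [ρ, this])
    exact treeDepth_of_decon G.G H.G B p (fun h => H.G.dist (ρ h) h) d w hp2 hp3
      (fun h => hrd _ _ (hρ h)) hB hBw
end

section
/- Let 𝒢 be a class of finite simple graphs. (1) If ℒ ⋠ 𝒢, then 𝒢 ≼ 𝒯. (2) If 𝒯 ⋠ 𝒢, then 𝒢 ≼ 𝒫. (3) If 𝒫 ⋠ 𝒢, then 𝒢 has bounded tree depth. -/
open SimpleGraph

/-! ### Reachability inside a set -/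

/-- `b` is reachable from `a` inside the set `X`. -/
def RIn {V : Type} (G : SimpleGraph V) (X : Set V) (a b : V) : Prop :=
  a ∈ X ∧ Relation.ReflTransGen (fun u v => G.Adj u v ∧ v ∈ X) a b

namespace RIn

variable {V : Type} {G G' : SimpleGraph V} {X Y : Set V} {a b c : V}

theorem refl (h : a ∈ X) : RIn G X a a := ⟨h, Relation.ReflTransGen.refl⟩

theorem left (h : RIn G X a b) : a ∈ X := h.1

theorem right (h : RIn G X a b) : b ∈ X := by
  obtain ⟨ha, h⟩ := h
  induction h with
  | refl => exact ha
  | tail _ h _ => exact h.2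

theorem trans (h : RIn G X a b) (h' : RIn G X b c) : RIn G X a c := ⟨h.1, h.2.trans h'.2⟩

theorem tail (h : RIn G X a b) (hb : G.Adj b c) (hc : c ∈ X) : RIn G X a c :=
  ⟨h.1, h.2.tail ⟨hb, hc⟩⟩

theorem adj (ha : a ∈ X) (hb : b ∈ X) (h : G.Adj a b) : RIn G X a b := (refl ha).tail h hb

/-- Induction principle. -/
theorem induct {P : V → Prop} (h : RIn G X a b) (h0 : P a)
    (hs : ∀ u v, RIn G X a u → P u → G.Adj u v → v ∈ X → P v) : P b := by
  obtain ⟨ha, h⟩ := h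
  induction h with
  | refl => exact h0
  | tail h1 h2 ih => exact hs _ _ ⟨ha, h1⟩ ih h2.1 h2.2

theorem symm (h : RIn G X a b) : RIn G X b a := by
  refine h.induct (P := fun u => RIn G X u a) (refl h.1) ?_
  intro u v hu hua huv hv
  exact (adj hv hu.right huv.symm).trans hua

theorem mono (h : RIn G X a b) (hX : X ⊆ Y) (hG : G ≤ G') : RIn G' Y a b := by
  refine h.induct (P := fun u => RIn G' Y a u) (refl (hX h.1)) ?_
  intro u v hu hua huv hv
  exact hua.tail (hG huv) (hX hv)

/-- Reachability stays inside the component. -/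
theorem inComp (h : RIn G X a b) : RIn G {u | RIn G X a u} a b := by
  refine h.induct (P := fun u => RIn G {u | RIn G X a u} a u) (refl (refl h.1)) ?_
  intro u v hu hua huv hv
  exact hua.tail huv (hu.tail huv hv)

end RIn

section conn

variable {V : Type} {G G' : SimpleGraph V} {X Y C : Set V} {a b c : V}

theorem connSet_iff : ConnSet G X ↔ X.Nonempty ∧ ∀ a ∈ X, ∀ b ∈ X, RIn G X a b := by
  unfold ConnSet
  rw [connected_iff]
  constructor
  · rintro ⟨h, ⟨x⟩⟩
    refine ⟨⟨x.1, x.2⟩, ?_⟩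
    intro a ha b hb
    have := h ⟨a, ha⟩ ⟨b, hb⟩
    rw [reachable_iff_reflTransGen] at this
    refine ⟨ha, ?_⟩
    exact Relation.ReflTransGen.lift (p := fun u v => G.Adj u v ∧ v ∈ X) (Subtype.val : X → V)
      (fun u v huv => ⟨huv, v.2⟩) _ _ this
  · rintro ⟨⟨x, hx⟩, h⟩
    refine ⟨?_, ⟨⟨x, hx⟩⟩⟩
    rintro ⟨a, ha⟩ ⟨b, hb⟩
    have hab := h a ha b hb
    have : ∃ hb : b ∈ X, (G.induce X).Reachable ⟨a, ha⟩ ⟨b, hb⟩ := by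
      refine hab.induct (P := fun u => ∃ hu : u ∈ X, (G.induce X).Reachable ⟨a, ha⟩ ⟨u, hu⟩)
        ⟨ha, Reachable.refl _⟩ ?_
      rintro u v hu ⟨hu', hr⟩ huv hv
      refine ⟨hv, hr.trans (Adj.reachable ?_)⟩
      exact huv
    exact this.2

theorem connSet_of_root (ha : a ∈ X) (h : ∀ b ∈ X, RIn G X a b) : ConnSet G X :=
  connSet_iff.2 ⟨⟨a, ha⟩, fun u hu v hv => (h u hu).symm.trans (h v hv)⟩

theorem ConnSet.rin (h : ConnSet G X) (ha : a ∈ X) (hb : b ∈ X) : RIn G X a b :=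
  (connSet_iff.1 h).2 a ha b hb

theorem ConnSet.nonempty (h : ConnSet G X) : X.Nonempty := (connSet_iff.1 h).1

theorem connSet_singleton (a : V) : ConnSet G {a} :=
  connSet_of_root (a := a) rfl (fun b hb => by rw [Set.mem_singleton_iff.1 hb]; exact RIn.refl rfl)

theorem connSet_comp (ha : a ∈ X) : ConnSet G {u | RIn G X a u} :=
  connSet_of_root (a := a) (RIn.refl ha) (fun _ hb => RIn.inComp hb)

theorem ConnSet.mono (h : ConnSet G X) (hG : G ≤ G') : ConnSet G' X := by
  obtain ⟨a, ha⟩ := h.nonempty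
  exact connSet_of_root ha (fun b hb => (h.rin ha hb).mono le_rfl hG)

theorem ConnSet.union (h : ConnSet G X) (h' : ConnSet G Y) (hXY : (X ∩ Y).Nonempty) :
    ConnSet G (X ∪ Y) := by
  obtain ⟨a, ha, ha'⟩ := hXY
  refine connSet_of_root (Or.inl ha) ?_
  rintro b (hb | hb)
  · exact (h.rin ha hb).mono Set.subset_union_left le_rfl
  · exact (h'.rin ha' hb).mono Set.subset_union_right le_rfl

theorem ConnSet.union_adj (h : ConnSet G X) (h' : ConnSet G Y) (ha : a ∈ X) (hb : b ∈ Y)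
    (hab : G.Adj a b) : ConnSet G (X ∪ Y) := by
  refine connSet_of_root (Or.inl ha) ?_
  rintro c (hc | hc)
  · exact (h.rin ha hc).mono Set.subset_union_left le_rfl
  · exact (RIn.adj (X := X ∪ Y) (Or.inl ha) (Or.inr hb) hab).trans
      ((h'.rin hb hc).mono Set.subset_union_right le_rfl)

theorem ConnSet.iUnion {ι : Type} {Q : ι → Set V} (h : ConnSet G X) (hQ : ∀ i, ConnSet G (Q i))
    (hi : ∀ i, (X ∩ Q i).Nonempty) : ConnSet G (X ∪ ⋃ i, Q i) := by
  obtain ⟨a, ha⟩ := h.nonempty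
  refine connSet_of_root (Or.inl ha) ?_
  rintro b (hb | hb)
  · exact (h.rin ha hb).mono Set.subset_union_left le_rfl
  · obtain ⟨i, hi'⟩ := Set.mem_iUnion.1 hb
    have := h.union (hQ i) (hi i)
    refine (this.rin (Or.inl ha) (Or.inr hi')).mono ?_ le_rfl
    exact Set.union_subset_union_right _ (Set.subset_iUnion _ i)

/-- A connected set meeting a relatively closed set is contained in it. -/
theorem ConnSet.subset_of_closed (h : ConnSet G C) (hm : (C ∩ X).Nonempty)
    (hcl : ∀ u ∈ C, u ∈ X → ∀ v ∈ C, G.Adj u v → v ∈ X) : C ⊆ X := by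
  obtain ⟨a, ha, ha'⟩ := hm
  intro b hb
  have hr := h.rin ha hb
  refine hr.induct (P := fun u => u ∈ X) ha' ?_
  intro u v hu hu' huv hv
  exact hcl u hu.right hu' v hv huv

/-- If a connected set is not inside `X` but meets it there is an edge leaving `X`. -/
theorem ConnSet.exists_adj (h : ConnSet G C) (hm : (C ∩ X).Nonempty) (hn : ¬ C ⊆ X) :
    ∃ u ∈ C, u ∈ X ∧ ∃ v ∈ C, v ∉ X ∧ G.Adj u v := by
  by_contra hcon
  push Not at hcon
  refine hn (h.subset_of_closed hm ?_)
  intro u hu hu' v hv huv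
  by_contra hvX
  exact hcon u hu hu' v hv hvX huv

theorem ConnSet.insert_adj (h : ConnSet G C) (ha : a ∈ C) (hab : G.Adj a b) :
    ConnSet G (insert b C) := by
  have := h.union_adj (connSet_singleton b) ha rfl hab
  rwa [Set.union_singleton] at this

theorem ConnSet.trim (h : ConnSet G C) {s : V} (ha : a ∈ C) (hs : s ∈ C) :
    ∃ C' ⊆ C, ConnSet G C' ∧ a ∈ C' ∧ s ∈ C' ∧ ∀ v ∈ C', v ≠ s → RIn G (C' \ {s}) a v := by
  by_cases has : a = s
  · subst has
    refine ⟨{a}, by simpa using ha, connSet_singleton a, rfl, rfl, ?_⟩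
    intro v hv hne
    exact absurd hv hne
  · have haX : a ∈ C \ {s} := ⟨ha, has⟩
    set K : Set V := {u | RIn G (C \ {s}) a u} with hK
    have hKC : K ⊆ C \ {s} := fun u hu => hu.right
    have key : s ∈ K ∨ ∃ w ∈ K, G.Adj w s := by
      refine (h.rin ha hs).induct (P := fun u => u ∈ K ∨ ∃ w ∈ K, G.Adj w s)
        (Or.inl (RIn.refl haX)) ?_
      rintro u v hu (hu' | hu') huv hv
      · by_cases hvs : v = s
        · subst hvs
          exact Or.inr ⟨u, hu', huv⟩
        · left
          exact RIn.tail hu' huv ⟨hv, hvs⟩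
      · exact Or.inr hu'
    have hsK : s ∉ K := fun h => (hKC h).2 rfl
    obtain ⟨w, hw, hws⟩ := key.resolve_left hsK
    refine ⟨insert s K, ?_, (connSet_comp haX).insert_adj hw hws, Or.inr (RIn.refl haX), Or.inl rfl, ?_⟩
    · intro u hu
      rcases hu with rfl | hu
      · exact hs
      · exact (hKC hu).1
    · intro v hv hne
      have hvK : v ∈ K := hv.resolve_left hne
      refine (RIn.inComp hvK).mono ?_ le_rfl
      intro u hu
      exact ⟨Or.inr hu, (hKC hu).2⟩

end conn


/-! ### The theorem of Menger -/

section menger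

variable {V : Type} {G G' : SimpleGraph V}

theorem menger_aux {x y : V} (hG' : ∀ u v, G.Adj u v → G'.Adj u v ∨ (u = x ∧ v = y) ∨ (u = y ∧ v = x))
    {S A B T : Set V} (hS : ∀ a ∈ A, ∀ b ∈ B, ¬ RIn G' Sᶜ a b)
    (hy : ∃ b ∈ B, RIn G' Sᶜ y b) (hT : ∀ a ∈ A, ∀ s ∈ insert x S, ¬ RIn G' Tᶜ a s) :
    ∀ a ∈ A, ∀ b ∈ B, ¬ RIn G Tᶜ a b := by
  intro a ha b hb hab
  have haS : a ∉ S := fun h => hT a ha a (Or.inr h) (RIn.refl hab.left)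
  have key : RIn G' Tᶜ a b ∧ RIn G' Sᶜ a b := by
    refine hab.induct (P := fun u => RIn G' Tᶜ a u ∧ RIn G' Sᶜ a u)
      ⟨RIn.refl hab.left, RIn.refl haS⟩ ?_
    rintro u w hu ⟨h1, h2⟩ huw hw
    rcases hG' u w huw with h | ⟨rfl, rfl⟩ | ⟨rfl, rfl⟩
    · have h3 := h1.tail h hw
      have hwS : w ∉ S := fun hws => hT a ha w (Or.inr hws) h3
      exact ⟨h3, h2.tail h hwS⟩
    · exact absurd h1 (hT a ha _ (Or.inl rfl))
    · obtain ⟨b', hb', hyb⟩ := hy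
      exact absurd (h2.trans hyb) (hS a ha b' hb')
  exact hS a ha b hb key.2

theorem linkage_reindex {k : ℕ} {A X : Set V} (hX : X.ncard = k) (hfin : X.Finite)
    {C : Fin k → Set V} (hC : ∀ i, ConnSet G (C i)) (hA : ∀ i, (C i ∩ A).Nonempty)
    (hCX : ∀ i, (C i ∩ X).Nonempty) (hd : ∀ i j, i ≠ j → Disjoint (C i) (C j)) :
    ∃ L : V → Set V, (∀ s ∈ X, ConnSet G (L s) ∧ s ∈ L s ∧ (L s ∩ A).Nonempty ∧
        (∀ v ∈ L s, v ≠ s → ∃ a ∈ A, RIn G Xᶜ a v) ∧ ∃ i, L s ⊆ C i) ∧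
      ∀ s ∈ X, ∀ t ∈ X, s ≠ t → Disjoint (L s) (L t) := by
  classical
  choose f hf using hCX
  have : Finite X := hfin
  have := Fintype.ofFinite X
  let g : Fin k → X := fun i => ⟨f i, (hf i).2⟩
  have hginj : Function.Injective g := by
    intro i j hij
    by_contra hne
    have h1 : f i = f j := congrArg Subtype.val hij
    exact Set.disjoint_left.1 (hd i j hne) (hf i).1 (h1 ▸ (hf j).1)
  have hgb : Function.Bijective g := by
    rw [Fintype.bijective_iff_injective_and_card]
    refine ⟨hginj, ?_⟩
    rw [Fintype.card_fin, ← hX, ← Nat.card_coe_set_eq, Nat.card_eq_fintype_card]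
  -- index for each s
  have hidx : ∀ s ∈ X, ∃ i, f i = s := by
    intro s hs
    obtain ⟨i, hi⟩ := hgb.2 ⟨s, hs⟩
    exact ⟨i, congrArg Subtype.val hi⟩
  have hex : ∀ s ∈ X, ∃ L : Set V, ∃ i, f i = s ∧ L ⊆ C i ∧ ConnSet G L ∧ s ∈ L ∧
      ∃ a ∈ A, a ∈ L ∧ ∀ v ∈ L, v ≠ s → RIn G (L \ {s}) a v := by
    intro s hs
    obtain ⟨i, hi⟩ := hidx s hs
    obtain ⟨a, haC, haA⟩ := hA i
    obtain ⟨C', h1, h2, h3, h4, h5⟩ := (hC i).trim haC (hi ▸ (hf i).1)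
    exact ⟨C', i, hi, h1, h2, h4, a, haA, h3, h5⟩
  choose! L idx h1 h2 h3 h4 a h5 h6 h7 using hex
  have hdis : ∀ s ∈ X, ∀ t ∈ X, s ≠ t → Disjoint (L s) (L t) := by
    intro s hs t ht hst
    have : idx s hs ≠ idx t ht := by
      intro h
      exact hst (by rw [← h1 s hs, ← h1 t ht, h])
    exact (hd _ _ this).mono (h2 s hs) (h2 t ht)
  refine ⟨L, ?_, hdis⟩
  intro s hs
  refine ⟨h3 s hs, h4 s hs, ⟨a s, h6 s hs, h5 s hs⟩, ?_, idx s hs, h2 s hs⟩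
  intro v hv hne
  refine ⟨a s, h5 s hs, (h7 s hs v hv hne).mono ?_ le_rfl⟩
  rintro u ⟨hu, hus⟩ huX
  exact Set.disjoint_left.1 (hdis s hs u huX (fun h => hus h.symm)) hu (h4 u huX)

theorem menger [Finite V] (k : ℕ) : ∀ (m : ℕ) (G : SimpleGraph V), G.edgeSet.ncard = m →
    ∀ A B : Set V, (∀ S : Set V, (∀ a ∈ A, ∀ b ∈ B, ¬ RIn G Sᶜ a b) → k ≤ S.ncard) →
    ∃ C : Fin k → Set V, (∀ i, ConnSet G (C i)) ∧ (∀ i, (C i ∩ A).Nonempty) ∧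
      (∀ i, (C i ∩ B).Nonempty) ∧ ∀ i j, i ≠ j → Disjoint (C i) (C j) := by
  classical
  intro m
  induction m using Nat.strong_induction_on with
  | _ m ih =>
  intro G hm A B hsep
  by_cases hE : ∃ x y, G.Adj x y
  swap
  · push Not at hE
    have h1 : k ≤ (A ∩ B).ncard := by
      apply hsep
      intro a ha b hb hab
      have : a = b := hab.induct (P := fun u => a = u) rfl (fun u v _ _ h _ => absurd h (hE u v))
      subst this
      exact hab.left ⟨ha, hb⟩
    have hfin : (A ∩ B).Finite := Set.toFinite _
    obtain ⟨t, ht, htc⟩ := Set.exists_subset_card_eq h1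
    have e : Nonempty (Fin k ≃ t) := by
      have : Nat.card t = k := by rw [Nat.card_coe_set_eq, htc]
      exact ⟨(Finite.equivFinOfCardEq this).symm⟩
    obtain ⟨e⟩ := e
    refine ⟨fun i => {(e i).1}, fun i => connSet_singleton _, ?_, ?_, ?_⟩
    · intro i
      exact ⟨(e i).1, rfl, (ht (e i).2).1⟩
    · intro i
      exact ⟨(e i).1, rfl, (ht (e i).2).2⟩
    · intro i j hij
      rw [Set.disjoint_singleton]
      exact fun h => hij (e.injective (Subtype.ext h))
  obtain ⟨x0, y0, hxy0⟩ := hE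
  set G' : SimpleGraph V := G.deleteEdges {s(x0, y0)} with hG'def
  have hle : G' ≤ G := deleteEdges_le _
  have hlt : G'.edgeSet.ncard < m := by
    rw [← hm]
    apply Set.ncard_lt_ncard _ (Set.toFinite _)
    rw [hG'def, edgeSet_deleteEdges]
    refine ⟨Set.sdiff_subset, ?_⟩
    intro h
    have := h (show s(x0, y0) ∈ G.edgeSet from hxy0)
    exact this.2 rfl
  have ih' := ih _ hlt G' rfl
  by_cases hgood : ∀ S : Set V, (∀ a ∈ A, ∀ b ∈ B, ¬ RIn G' Sᶜ a b) → k ≤ S.ncard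
  · obtain ⟨C, h1, h2, h3, h4⟩ := ih' A B hgood
    exact ⟨C, fun i => (h1 i).mono hle, h2, h3, h4⟩
  push Not at hgood
  obtain ⟨S, hS, hSk⟩ := hgood
  have hnot : ¬ ∀ a ∈ A, ∀ b ∈ B, ¬ RIn G Sᶜ a b := fun h => absurd (hsep S h) (by omega)
  push Not at hnot
  obtain ⟨a0, ha0, b0, hb0, hab0⟩ := hnot
  have hdel : ∀ u v, G.Adj u v → G'.Adj u v ∨ (u = x0 ∧ v = y0) ∨ (u = y0 ∧ v = x0) := by
    intro u v huv
    by_cases h : s(u, v) = s(x0, y0)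
    · right
      rw [Sym2.eq_iff] at h
      exact h
    · left
      rw [hG'def, deleteEdges_adj]
      exact ⟨huv, h⟩
  set Ra : Set V := {u | ∃ a ∈ A, RIn G' Sᶜ a u} with hRa
  set Rb : Set V := {u | ∃ b ∈ B, RIn G' Sᶜ b u} with hRb
  have hRab : ∀ u, u ∈ Ra → u ∉ Rb := by
    rintro u ⟨a, ha, hau⟩ ⟨b, hb, hbu⟩
    exact hS a ha b hb (hau.trans hbu.symm)
  have hRaS : ∀ u ∈ Ra, u ∉ S := by
    rintro u ⟨a, ha, hau⟩
    exact hau.right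
  have hRbS : ∀ u ∈ Rb, u ∉ S := by
    rintro u ⟨a, ha, hau⟩
    exact hau.right
  have haRa : a0 ∈ Ra := ⟨a0, ha0, RIn.refl hab0.left⟩
  have hbRb : b0 ∈ Rb := ⟨b0, hb0, RIn.refl hab0.right⟩
  have hstep1 : ∃ u v, G.Adj u v ∧ u ∈ Ra ∧ v ∉ Ra ∧ v ∉ S := by
    by_contra hcon
    push Not at hcon
    refine hRab b0 ?_ hbRb
    refine hab0.induct (P := fun u => u ∈ Ra) haRa ?_
    intro u v _ hu huv hv
    by_contra hvR
    exact hv (hcon u v huv hu hvR)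
  have hstep2 : ∃ u v, G.Adj u v ∧ u ∈ Rb ∧ v ∉ Rb ∧ v ∉ S := by
    by_contra hcon
    push Not at hcon
    refine hRab a0 haRa ?_
    refine hab0.symm.induct (P := fun u => u ∈ Rb) hbRb ?_
    intro u v _ hu huv hv
    by_contra hvR
    exact hv (hcon u v huv hu hvR)
  have hxy : ∃ x y, x ∈ Ra ∧ y ∈ Rb ∧ G.Adj x y ∧
      ∀ u v, G.Adj u v → G'.Adj u v ∨ (u = x ∧ v = y) ∨ (u = y ∧ v = x) := by
    obtain ⟨u, v, huv, hu, hv, hvS⟩ := hstep1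
    obtain ⟨u', v', huv', hu', hv', hvS'⟩ := hstep2
    have h1 : ¬ G'.Adj u v := by
      intro h
      obtain ⟨a, ha, hau⟩ := hu
      exact hv ⟨a, ha, hau.tail h hvS⟩
    have h2 : ¬ G'.Adj u' v' := by
      intro h
      obtain ⟨a, ha, hau⟩ := hu'
      exact hv' ⟨a, ha, hau.tail h hvS'⟩
    have h3 := (hdel u v huv).resolve_left h1
    have h4 := (hdel u' v' huv').resolve_left h2
    have hu'v : u' = v := by
      rcases h3 with ⟨rfl, rfl⟩ | ⟨rfl, rfl⟩ <;> rcases h4 with ⟨rfl, rfl⟩ | ⟨rfl, rfl⟩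
      · exact absurd hu' (hRab _ hu)
      · rfl
      · rfl
      · exact absurd hu' (hRab _ hu)
    refine ⟨u, v, hu, hu'v ▸ hu', huv, ?_⟩
    intro p q hpq
    rcases h3 with ⟨rfl, rfl⟩ | ⟨rfl, rfl⟩
    · exact hdel p q hpq
    · have := hdel p q hpq
      tauto
  clear hstep1 hstep2
  obtain ⟨x, y, hx, hy, hadj, hdel'⟩ := hxy
  have hxS := hRaS x hx
  have hyS := hRbS y hy
  have hS' : ∀ b ∈ B, ∀ a ∈ A, ¬ RIn G' Sᶜ b a := fun b hb a ha h => hS a ha b hb h.symm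
  -- A to X
  have hAX : ∀ T : Set V, (∀ a ∈ A, ∀ s ∈ insert x S, ¬ RIn G' Tᶜ a s) → k ≤ T.ncard := by
    intro T hT
    apply hsep
    obtain ⟨b, hb, hby⟩ := hy
    exact menger_aux hdel' hS ⟨b, hb, hby.symm⟩ hT
  have hBY : ∀ T : Set V, (∀ b ∈ B, ∀ s ∈ insert y S, ¬ RIn G' Tᶜ b s) → k ≤ T.ncard := by
    intro T hT
    apply hsep
    obtain ⟨a, ha, hax⟩ := hx
    have := menger_aux (x := y) (y := x) (G := G) (G' := G') (fun u v h => by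
      have := hdel' u v h
      tauto) hS' ⟨a, ha, hax.symm⟩ hT
    exact fun a ha b hb h => this b hb a ha h.symm
  have hXk : (insert x S).ncard = k := by
    have h1 : k ≤ (insert x S).ncard := hAX _ (fun a ha s hs h => h.right hs)
    have h2 := Set.ncard_insert_le x S
    omega
  have hYk : (insert y S).ncard = k := by
    have h1 : k ≤ (insert y S).ncard := hBY _ (fun a ha s hs h => h.right hs)
    have h2 := Set.ncard_insert_le y S
    omega
  obtain ⟨C, c1, c2, c3, c4⟩ := ih' A (insert x S) hAX
  obtain ⟨D, d1, d2, d3, d4⟩ := ih' B (insert y S) hBY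
  obtain ⟨L, hL, hLd⟩ := linkage_reindex hXk (Set.toFinite _) c1 c2 c3 c4
  obtain ⟨M, hM, hMd⟩ := linkage_reindex hYk (Set.toFinite _) d1 d2 d3 d4
  have hLv : ∀ s ∈ insert x S, ∀ v ∈ L s, v ∈ Ra ∨ (v = s ∧ s ∈ S) := by
    intro s hs v hv
    by_cases hvs : v = s
    · subst hvs
      rcases hs with rfl | hs
      · exact Or.inl hx
      · exact Or.inr ⟨rfl, hs⟩
    · left
      obtain ⟨a, ha, h⟩ := (hL s hs).2.2.2.1 v hv hvs
      exact ⟨a, ha, h.mono (Set.compl_subset_compl.2 (Set.subset_insert _ _)) le_rfl⟩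
  have hMv : ∀ s ∈ insert y S, ∀ v ∈ M s, v ∈ Rb ∨ (v = s ∧ s ∈ S) := by
    intro s hs v hv
    by_cases hvs : v = s
    · subst hvs
      rcases hs with rfl | hs
      · exact Or.inl hy
      · exact Or.inr ⟨rfl, hs⟩
    · left
      obtain ⟨a, ha, h⟩ := (hM s hs).2.2.2.1 v hv hvs
      exact ⟨a, ha, h.mono (Set.compl_subset_compl.2 (Set.subset_insert _ _)) le_rfl⟩
  let σ : V → V := fun s => if s = x then y else s
  have hσx : σ x = y := by simp [σ]
  have hσS : ∀ s ∈ S, σ s = s := by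
    intro s hs
    have : s ≠ x := fun h => hxS (h ▸ hs)
    simp [σ, this]
  have hσY : ∀ s ∈ insert x S, σ s ∈ insert y S := by
    rintro s (rfl | hs)
    · rw [hσx]; exact Or.inl rfl
    · rw [hσS s hs]; exact Or.inr hs
  have hσinj : ∀ s ∈ insert x S, ∀ t ∈ insert x S, σ s = σ t → s = t := by
    rintro s (rfl | hs) t (rfl | ht) h
    · rfl
    · rw [hσx, hσS t ht] at h
      exact absurd (h ▸ ht) hyS
    · rw [hσx, hσS s hs] at h
      exact absurd (h ▸ hs) hyS
    · rwa [hσS s hs, hσS t ht] at h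
  have hcross : ∀ s ∈ insert x S, ∀ t ∈ insert x S, s ≠ t → Disjoint (L s) (M (σ t)) := by
    intro s hs t ht hst
    rw [Set.disjoint_left]
    intro v hvL hvM
    rcases hLv s hs v hvL with h1 | ⟨h1, h1'⟩ <;> rcases hMv _ (hσY t ht) v hvM with h2 | ⟨h2, h2'⟩
    · exact hRab v h1 h2
    · exact hRaS v h1 (h2 ▸ h2')
    · exact hRbS v h2 (h1 ▸ h1')
    · apply hst
      apply hσinj s hs t ht
      rw [hσS s h1', ← h1, h2]
  have hcard : Nat.card (insert x S : Set V) = k := by rw [Nat.card_coe_set_eq, hXk]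
  let e : Fin k ≃ (insert x S : Set V) := (Finite.equivFinOfCardEq hcard).symm
  refine ⟨fun i => L (e i).1 ∪ M (σ (e i).1), ?_, ?_, ?_, ?_⟩
  · intro i
    show ConnSet G (L (e i).1 ∪ M (σ (e i).1))
    generalize e i = s'
    obtain ⟨s, hs⟩ := s'
    have l := hL s hs
    have r := hM _ (hσY s hs)
    have l1 := l.1.mono hle
    have r1 := r.1.mono hle
    rcases hs with rfl | hs
    · simp only [hσx] at *
      exact l1.union_adj r1 l.2.1 r.2.1 hadj
    · simp only [hσS s hs] at *
      exact l1.union r1 ⟨s, l.2.1, r.2.1⟩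
  · intro i
    obtain ⟨v, hv, hvA⟩ := (hL _ (e i).2).2.2.1
    exact ⟨v, Or.inl hv, hvA⟩
  · intro i
    obtain ⟨v, hv, hvA⟩ := (hM _ (hσY _ (e i).2)).2.2.1
    exact ⟨v, Or.inr hv, hvA⟩
  · intro i j hij
    have hne : (e i).1 ≠ (e j).1 := fun h => hij (e.injective (Subtype.ext h))
    rw [Set.disjoint_union_left, Set.disjoint_union_right, Set.disjoint_union_right]
    refine ⟨⟨hLd _ (e i).2 _ (e j).2 hne, hcross _ (e i).2 _ (e j).2 hne⟩,
      ⟨(hcross _ (e j).2 _ (e i).2 hne.symm).symm, ?_⟩⟩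
    apply hMd _ (hσY _ (e i).2) _ (hσY _ (e j).2)
    exact fun h => hne (hσinj _ (e i).2 _ (e j).2 h)

end menger


/-! ### Excluding a tree: bounded path-width -/

/-- Inner vertex boundary. -/
def bdry {V : Type} (G : SimpleGraph V) (A : Set V) : Set V := {v | v ∈ A ∧ ∃ u, u ∉ A ∧ G.Adj v u}

/-- Sets that can be swept from the empty set with boundaries of size at most `n`. -/
inductive GoodSet {V : Type} (G : SimpleGraph V) (n : ℕ) : Set V → Prop
  | empty : GoodSet G n ∅
  | step (A : Set V) (y : V) : GoodSet G n A → (bdry G (insert y A)).ncard ≤ n →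
      GoodSet G n (insert y A)

section sweep

variable {V : Type} {G : SimpleGraph V}

theorem bdry_submod [Finite V] (A B : Set V) :
    (bdry G (A ∩ B)).ncard + (bdry G (A ∪ B)).ncard ≤ (bdry G A).ncard + (bdry G B).ncard := by
  rw [← Set.ncard_union_add_ncard_inter (bdry G (A ∩ B)), ← Set.ncard_union_add_ncard_inter (bdry G A)]
  apply Nat.add_le_add
  · apply Set.ncard_le_ncard _ (Set.toFinite _)
    rintro v (⟨⟨h1, h2⟩, u, hu, huv⟩ | ⟨h1, u, hu, huv⟩)
    · by_cases huA : u ∈ A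
      · exact Or.inr ⟨h2, u, fun h => hu ⟨huA, h⟩, huv⟩
      · exact Or.inl ⟨h1, u, huA, huv⟩
    · rcases h1 with h1 | h1
      · exact Or.inl ⟨h1, u, fun h => hu (Or.inl h), huv⟩
      · exact Or.inr ⟨h1, u, fun h => hu (Or.inr h), huv⟩
  · apply Set.ncard_le_ncard _ (Set.toFinite _)
    rintro v ⟨⟨⟨h1, h2⟩, _⟩, ⟨_, u, hu, huv⟩⟩
    exact ⟨⟨h1, u, fun h => hu (Or.inl h), huv⟩, ⟨h2, u, fun h => hu (Or.inr h), huv⟩⟩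

theorem bdry_insert_subset (A : Set V) (y : V) : bdry G (insert y A) ⊆ insert y (bdry G A) := by
  rintro v ⟨h1, u, hu, huv⟩
  rcases h1 with rfl | h1
  · exact Or.inl rfl
  · exact Or.inr ⟨h1, u, fun h => hu (Or.inr h), huv⟩

theorem good_inter [Finite V] {n : ℕ} {D A' : Set V} (hD : D ⊆ A')
    (hmin : ∀ E, D ⊆ E → E ⊆ A' → (bdry G D).ncard ≤ (bdry G E).ncard) (hA' : GoodSet G n A') :
    GoodSet G n D := by
  have key : ∀ A, GoodSet G n A → A ⊆ A' → GoodSet G n (A ∩ D) := by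
    intro A hA
    induction hA with
    | empty => intro _; rw [Set.empty_inter]; exact GoodSet.empty
    | step A y hA hn ih =>
      intro hsub
      have ih' := ih (fun u hu => hsub (Or.inr hu))
      by_cases hy : y ∈ D
      · have h1 := bdry_submod (G := G) (insert y A) D
        have h2 := hmin (insert y A ∪ D) Set.subset_union_right (Set.union_subset hsub hD)
        have h3 : (insert y A) ∩ D = insert y (A ∩ D) := by
          rw [Set.insert_inter_of_mem hy]
        rw [h3] at h1 ⊢
        exact GoodSet.step _ _ ih' (by omega)
      · rw [Set.insert_inter_of_notMem hy]
        exact ih'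
  have := key A' hA' le_rfl
  rwa [Set.inter_eq_self_of_subset_right hD] at this

/-- The invariant in the proof of the path-width theorem. -/
structure Stage {τ : Type} (T : SimpleGraph τ) (G : SimpleGraph V) (n : ℕ) (U : Finset τ)
    (A : Set V) (μ : τ → Set V) (x : τ → V) : Prop where
  good : GoodSet G n A
  card : (bdry G A).ncard = U.card
  maxl : ∀ E, GoodSet G n E → A ⊆ E → (bdry G E).ncard ≤ U.card → E = A
  conn : ∀ t ∈ U, ConnSet G (μ t)
  sub : ∀ t ∈ U, μ t ⊆ A
  xmem : ∀ t ∈ U, x t ∈ μ t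
  xbd : ∀ t ∈ U, x t ∈ bdry G A
  disj : ∀ s ∈ U, ∀ t ∈ U, s ≠ t → Disjoint (μ s) (μ t)
  adj : ∀ s ∈ U, ∀ t ∈ U, T.Adj s t → ∃ g ∈ μ s, ∃ g' ∈ μ t, G.Adj g g'

theorem Stage.surj [Finite V] {τ : Type} {T : SimpleGraph τ} {n : ℕ} {U : Finset τ}
    {A : Set V} {μ : τ → Set V} {x : τ → V} (h : Stage T G n U A μ x) :
    ∀ v ∈ bdry G A, ∃ t ∈ U, x t = v := by
  classical
  have hinj : Set.InjOn x (U : Set τ) := by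
    intro s hs t ht hst
    by_contra hne
    exact Set.disjoint_left.1 (h.disj s hs t ht hne) (h.xmem s hs) (hst ▸ h.xmem t ht)
  have h1 : (x '' (U : Set τ)) = bdry G A := by
    apply Set.eq_of_subset_of_ncard_le
    · rintro _ ⟨t, ht, rfl⟩
      exact h.xbd t ht
    · rw [hinj.ncard_image, h.card, Set.ncard_coe_finset]
    · exact Set.toFinite _
  intro v hv
  rw [← h1] at hv
  exact hv

theorem Stage.step [Finite V] {τ : Type} [DecidableEq τ] {T : SimpleGraph τ} {n : ℕ} {U : Finset τ}
    {A : Set V} {μ : τ → Set V} {x : τ → V} (h : Stage T G n U A μ x) {t : τ} (ht : t ∉ U)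
    (hn : U.card + 1 ≤ n) {y : V} (hyA : y ∉ A) (hy : ∀ u ∈ U, T.Adj u t → G.Adj (x u) y) :
    ∃ A' μ' x', Stage T G n (insert t U) A' μ' x' := by
  classical
  set i := U.card with hi
  set A1 := insert y A with hA1
  have hAA1 : A ⊆ A1 := Set.subset_insert _ _
  have hsub1 : bdry G A1 ⊆ insert y (bdry G A) := bdry_insert_subset A y
  have hc0 : (insert y (bdry G A)).ncard ≤ i + 1 := by
    have := Set.ncard_insert_le y (bdry G A)
    rw [h.card] at this
    exact this
  have hc1 : (bdry G A1).ncard ≤ i + 1 := (Set.ncard_le_ncard hsub1 (Set.toFinite _)).trans hc0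
  have hg1 : GoodSet G n A1 := GoodSet.step _ _ h.good (hc1.trans hn)
  have hnosmall : ∀ E, GoodSet G n E → A1 ⊆ E → ¬ (bdry G E).ncard ≤ i := by
    intro E hE hsub hle
    have := h.maxl E hE (hAA1.trans hsub) hle
    exact hyA (this ▸ hsub (Or.inl rfl))
  have hc1' : (bdry G A1).ncard = i + 1 := by
    have := hnosmall A1 hg1 le_rfl
    omega
  have hX : bdry G A1 = insert y (bdry G A) :=
    Set.eq_of_subset_of_ncard_le hsub1 (by omega) (Set.toFinite _)
  obtain ⟨A', ⟨hgA', hA1A', hcA'⟩, hmaxA'⟩ := Set.exists_max_image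
    {E | GoodSet G n E ∧ A1 ⊆ E ∧ (bdry G E).ncard ≤ i + 1} (fun E => E.ncard) (Set.toFinite _)
    ⟨A1, hg1, le_rfl, hc1⟩
  have hcA'' : (bdry G A').ncard = i + 1 := by
    have := hnosmall A' hgA' hA1A'
    omega
  set X := bdry G A1 with hXdef
  set Y := bdry G A' with hYdef
  set W : Set V := A' \ (A1 \ X) with hW
  have hXA1 : X ⊆ A1 := fun v hv => hv.1
  have hXW : X ⊆ W := fun v hv => ⟨hA1A' (hXA1 hv), fun h => h.2 hv⟩
  have hYX : ∀ v ∈ Y, v ∈ A1 → v ∈ X := by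
    rintro v ⟨hv, u, hu, huv⟩ hv1
    exact ⟨hv1, u, fun h => hu (hA1A' h), huv⟩
  let G2 : SimpleGraph V :=
    { Adj := fun u v => G.Adj u v ∧ u ∈ W ∧ v ∈ W
      symm := ⟨fun u v h => ⟨h.1.symm, h.2.2, h.2.1⟩⟩
      loopless := ⟨fun u h => G.loopless.irrefl u h.1⟩ }
  have hG2 : G2 ≤ G := fun u v h => h.1
  have hsep : ∀ S : Set V, (∀ a ∈ Y, ∀ b ∈ X, ¬ RIn G2 Sᶜ a b) → i + 1 ≤ S.ncard := by
    intro S hS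
    by_contra hlt
    set R : Set V := {u | ∃ b ∈ Y, RIn G (A' ∩ Sᶜ) b u} with hR
    have hDS : bdry G (A' \ R) ⊆ S := by
      rintro v ⟨⟨hvA, hvR⟩, u, hu, huv⟩
      by_contra hvS
      by_cases huA : u ∈ A'
      · have huR : u ∈ R := by
          by_contra huR
          exact hu ⟨huA, huR⟩
        obtain ⟨b, hb, hbu⟩ := huR
        exact hvR ⟨b, hb, hbu.tail huv.symm ⟨hvA, hvS⟩⟩
      · exact hvR ⟨v, ⟨hvA, u, huA, huv⟩, RIn.refl ⟨hvA, hvS⟩⟩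
    have hA1D : A1 ⊆ A' \ R := by
      intro v hv
      refine ⟨hA1A' hv, ?_⟩
      rintro ⟨b, hb, hbv⟩
      have hbA1 : b ∉ A1 := by
        intro hb1
        exact hS b hb b (hYX b hb hb1) (RIn.refl hbv.left.2)
      have : v ∉ A1 ∧ RIn G2 Sᶜ b v := by
        refine hbv.induct (P := fun u => u ∉ A1 ∧ RIn G2 Sᶜ b u) ⟨hbA1, RIn.refl hbv.left.2⟩ ?_
        rintro u w hu ⟨hu1, hu2⟩ huw hw
        have huW : u ∈ W := ⟨hu.right.1, fun h => hu1 h.1⟩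
        have hwW : w ∈ W := by
          refine ⟨hw.1, fun h => h.2 ?_⟩
          exact ⟨h.1, u, hu1, huw.symm⟩
        have hr : RIn G2 Sᶜ b w := hu2.tail (show G2.Adj u w from ⟨huw, huW, hwW⟩) hw.2
        refine ⟨fun hw1 => ?_, hr⟩
        exact hS b hb w ⟨hw1, u, hu1, huw.symm⟩ hr
      exact this.1 hv
    obtain ⟨D, ⟨hD1, hD2⟩, hDmin⟩ := Set.exists_min_image
      {E | A1 ⊆ E ∧ E ⊆ A'} (fun E => (bdry G E).ncard) (Set.toFinite _) ⟨A1, le_rfl, hA1A'⟩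
    have hDgood : GoodSet G n D :=
      good_inter hD2 (fun E h1 h2 => hDmin E ⟨hD1.trans h1, h2⟩) hgA'
    apply hnosmall D hDgood hD1
    have h1 := hDmin (A' \ R) ⟨hA1D, fun v hv => hv.1⟩
    have h2 := Set.ncard_le_ncard hDS (Set.toFinite _)
    omega
  obtain ⟨C, c1, c2, c3, c4⟩ := menger (i + 1) _ G2 rfl Y X hsep
  obtain ⟨L, hL, hLd⟩ := linkage_reindex hc1' (Set.toFinite _) c1 c2 c3 c4
  have hLW : ∀ s ∈ X, L s ⊆ W := by
    intro s hs
    refine (hL s hs).1.subset_of_closed ⟨s, (hL s hs).2.1, hXW hs⟩ ?_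
    intro u _ _ v _ huv
    exact huv.2.2
  have hz : ∀ s ∈ X, ∃ z, z ∈ L s ∧ z ∈ Y := fun s hs => (hL s hs).2.2.1
  choose! z hz1 hz2 using hz
  have hyX : y ∈ X := by rw [hX]; exact Or.inl rfl
  have hxX : ∀ u ∈ U, x u ∈ X := fun u hu => by rw [hX]; exact Or.inr (h.xbd u hu)
  have hxA : ∀ u ∈ U, x u ∈ A := fun u hu => (h.xbd u hu).1
  have hxy : ∀ u ∈ U, x u ≠ y := fun u hu he => hyA (he ▸ hxA u hu)
  have hxinj : ∀ u ∈ U, ∀ v ∈ U, u ≠ v → x u ≠ x v := by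
    intro u hu v hv hne he
    exact Set.disjoint_left.1 (h.disj u hu v hv hne) (h.xmem u hu) (he ▸ h.xmem v hv)
  have hμL : ∀ u ∈ U, ∀ s ∈ X, s ≠ x u → Disjoint (μ u) (L s) := by
    intro u hu s hs hne
    rw [Set.disjoint_left]
    intro v hv hvL
    have hvA := h.sub u hu hv
    have hvX : v ∈ X := by
      by_contra hvX
      exact (hLW s hs hvL).2 ⟨hAA1 hvA, hvX⟩
    have hvb : v ∈ bdry G A := by
      rw [hX] at hvX
      exact hvX.resolve_left (fun he => hyA (he ▸ hvA))
    obtain ⟨u', hu', hxu'⟩ := h.surj v hvb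
    have huu : u = u' := by
      by_contra hne'
      exact Set.disjoint_left.1 (h.disj u hu u' hu' hne') hv (hxu' ▸ h.xmem u' hu')
    subst huu
    exact Set.disjoint_left.1 (hLd s hs v hvX (fun he => hne (he.trans hxu'.symm))) hvL
      (hL v hvX).2.1
  let μ' : τ → Set V := fun u => if u = t then L y else μ u ∪ L (x u)
  let x' : τ → V := fun u => if u = t then z y else z (x u)
  have hμt : μ' t = L y := by simp [μ']
  have hxt : x' t = z y := by simp [x']
  have hUt : ∀ u ∈ U, u ≠ t := fun u hu he => ht (he ▸ hu)
  have hμU : ∀ u ∈ U, μ' u = μ u ∪ L (x u) := by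
    intro u hu
    simp [μ', hUt u hu]
  have hxU : ∀ u ∈ U, x' u = z (x u) := by
    intro u hu
    simp [x', hUt u hu]
  have hcardU : (insert t U).card = i + 1 := Finset.card_insert_of_notMem ht
  have hdisj1 : ∀ u ∈ U, Disjoint (μ' u) (μ' t) := by
    intro u hu
    rw [hμU u hu, hμt, Set.disjoint_union_left]
    exact ⟨hμL u hu y hyX (hxy u hu).symm, hLd _ (hxX u hu) _ hyX (hxy u hu)⟩
  have hadj1 : ∀ u ∈ U, T.Adj u t → ∃ g ∈ μ' u, ∃ g' ∈ μ' t, G.Adj g g' := by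
    intro u hu hut
    rw [hμU u hu, hμt]
    exact ⟨x u, Or.inl (h.xmem u hu), y, (hL y hyX).2.1, hy u hu hut⟩
  refine ⟨A', μ', x', ?_⟩
  refine ⟨hgA', by rw [hcardU]; exact hcA'', ?_, ?_, ?_, ?_, ?_, ?_, ?_⟩
  · intro E hE hsub hle
    rw [hcardU] at hle
    exact (Set.eq_of_subset_of_ncard_le hsub (hmaxA' E ⟨hE, hA1A'.trans hsub, hle⟩)
      (Set.toFinite _)).symm
  · intro u hu
    rcases Finset.mem_insert.1 hu with rfl | hu
    · rw [hμt]; exact (hL y hyX).1.mono hG2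
    · rw [hμU u hu]
      exact (h.conn u hu).union ((hL _ (hxX u hu)).1.mono hG2)
        ⟨x u, h.xmem u hu, (hL _ (hxX u hu)).2.1⟩
  · intro u hu
    rcases Finset.mem_insert.1 hu with rfl | hu
    · rw [hμt]; exact fun v hv => (hLW y hyX hv).1
    · rw [hμU u hu]
      rintro v (hv | hv)
      · exact hA1A' (hAA1 (h.sub u hu hv))
      · exact (hLW _ (hxX u hu) hv).1
  · intro u hu
    rcases Finset.mem_insert.1 hu with rfl | hu
    · rw [hμt, hxt]; exact hz1 y hyX
    · rw [hμU u hu, hxU u hu]; exact Or.inr (hz1 _ (hxX u hu))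
  · intro u hu
    rcases Finset.mem_insert.1 hu with rfl | hu
    · rw [hxt]; exact hz2 y hyX
    · rw [hxU u hu]; exact hz2 _ (hxX u hu)
  · intro u hu v hv hne
    rcases Finset.mem_insert.1 hu with hu1 | hu1 <;> rcases Finset.mem_insert.1 hv with hv1 | hv1
    · exact absurd (hu1.trans hv1.symm) hne
    · rw [hu1]; exact (hdisj1 v hv1).symm
    · rw [hv1]; exact hdisj1 u hu1
    · rw [hμU u hu1, hμU v hv1, Set.disjoint_union_left, Set.disjoint_union_right,
        Set.disjoint_union_right]
      have hxne := hxinj u hu1 v hv1 hne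
      exact ⟨⟨h.disj u hu1 v hv1 hne, hμL u hu1 _ (hxX v hv1) hxne.symm⟩,
        ⟨(hμL v hv1 _ (hxX u hu1) hxne).symm, hLd _ (hxX u hu1) _ (hxX v hv1) hxne⟩⟩
  · intro u hu v hv hadj
    rcases Finset.mem_insert.1 hu with hu1 | hu1 <;> rcases Finset.mem_insert.1 hv with hv1 | hv1
    · rw [hu1, hv1] at hadj; exact absurd hadj (T.loopless.irrefl t)
    · rw [hu1] at hadj ⊢
      obtain ⟨g, hg, g', hg', hgg⟩ := hadj1 v hv1 hadj.symm
      exact ⟨g', hg', g, hg, hgg.symm⟩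
    · rw [hv1] at hadj ⊢
      exact hadj1 u hu1 hadj
    · obtain ⟨g, hg, g', hg', hgg⟩ := h.adj u hu1 v hv1 hadj
      rw [hμU u hu1, hμU v hv1]
      exact ⟨g, Or.inl hg, g', Or.inl hg', hgg⟩

theorem tree_unique_nbr {τ : Type} {T : SimpleGraph τ} (hT : T.IsAcyclic) {U : Set τ}
    (hU : ConnSet T U) {t u u' : τ} (ht : t ∉ U) (hu : u ∈ U) (hu' : u' ∈ U) (h : T.Adj u t)
    (h' : T.Adj u' t) : u' = u := by
  by_contra hne
  have hb := isAcyclic_iff_forall_adj_isBridge.1 hT h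
  rw [isBridge_iff] at hb
  apply hb
  have h1 : (T.deleteEdges {s(u, t)}).Reachable u u' := by
    refine (hU.rin hu hu').induct (P := fun w => (T.deleteEdges {s(u, t)}).Reachable u w)
      (Reachable.refl _) ?_
    intro a b ha har hab hb
    refine har.trans (Adj.reachable ?_)
    rw [deleteEdges_adj]
    refine ⟨hab, ?_⟩
    intro he
    rcases Sym2.eq_iff.1 he with ⟨_, h2⟩ | ⟨h2, _⟩
    · exact ht (h2 ▸ hb)
    · exact ht (h2 ▸ ha.right)
  refine h1.trans (Adj.reachable ?_)
  rw [deleteEdges_adj]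
  refine ⟨h', ?_⟩
  intro he
  rcases Sym2.eq_iff.1 he with ⟨h2, _⟩ | ⟨h2, _⟩
  · exact hne h2
  · exact ht (h2 ▸ hu')

theorem tree_minor_or_good [Finite V] {τ : Type} [Fintype τ] {T : SimpleGraph τ} (hT : T.IsTree) :
    GoodSet G (Fintype.card τ) Set.univ ∨ ∃ μ : τ → Set V, IsMinorMap T G μ := by
  classical
  by_cases hgood : GoodSet G (Fintype.card τ) (Set.univ : Set V)
  · exact Or.inl hgood
  right
  set n := Fintype.card τ with hn
  have hTc : ConnSet T Set.univ := by
    have := (Iso.connected_iff (induceUnivIso T)).2 hT.1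
    exact this
  have key : ∀ i, i ≤ n → ∃ (U : Finset τ) (A : Set V) (μ : τ → Set V) (x : τ → V),
      U.card = i ∧ (U.Nonempty → ConnSet T (U : Set τ)) ∧ Stage T G n U A μ x := by
    intro i
    induction i with
    | zero =>
      intro _
      obtain ⟨A, ⟨hA1, hA2⟩, hmax⟩ := Set.exists_max_image
        {E | GoodSet G n E ∧ (bdry G E).ncard ≤ 0} (fun E => E.ncard) (Set.toFinite _)
        ⟨∅, GoodSet.empty, by
          have : bdry G ∅ = ∅ := by
            ext v; simp [bdry]
          rw [this, Set.ncard_empty]⟩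
      by_cases hV : Nonempty V
      swap
      · exact absurd (by
          have : (Set.univ : Set V) = ∅ := by
            rw [Set.univ_eq_empty_iff]; exact not_nonempty_iff.1 hV
          rw [this]; exact GoodSet.empty) hgood
      obtain ⟨v0⟩ := hV
      refine ⟨∅, A, fun _ => ∅, fun _ => v0, rfl, by simp, ?_⟩
      refine ⟨hA1, by simpa using hA2, ?_, by simp, by simp, by simp, by simp, by simp, by simp⟩
      intro E hE hsub hle
      exact (Set.eq_of_subset_of_ncard_le hsub (hmax E ⟨hE, by simpa using hle⟩)
        (Set.toFinite _)).symm
    | succ i ih =>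
      intro hi
      obtain ⟨U, A, μ, x, hc, hconn, hst⟩ := ih (by omega)
      by_cases hU : U.Nonempty
      · have hne : ¬ (Set.univ : Set τ) ⊆ U := by
          intro hsub
          have : U = Finset.univ := by
            ext v
            simpa using hsub (Set.mem_univ v)
          rw [this, Finset.card_univ] at hc
          omega
        obtain ⟨u0, hu0⟩ := hU
        obtain ⟨u, _, hu, t, _, ht, hadj⟩ := hTc.exists_adj (X := (U : Set τ)) ⟨u0, trivial, hu0⟩ hne
        obtain ⟨_, y, hyA, hxy⟩ := hst.xbd u hu
        have hUc := hconn ⟨u0, hu0⟩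
        obtain ⟨A', μ', x', hst'⟩ := hst.step (t := t) ht (by omega) hyA (by
          intro u' hu' hadj'
          rw [tree_unique_nbr hT.2 hUc ht hu hu' hadj hadj']
          exact hxy)
        refine ⟨insert t U, A', μ', x', ?_, ?_, hst'⟩
        · rw [Finset.card_insert_of_notMem ht, hc]
        · intro _
          rw [Finset.coe_insert]
          exact hUc.insert_adj hu hadj
      · rw [Finset.not_nonempty_iff_eq_empty] at hU
        subst hU
        have hAne : A ≠ Set.univ := fun h => hgood (h ▸ hst.good)
        obtain ⟨y, hyA⟩ := (Set.ne_univ_iff_exists_notMem A).1 hAne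
        have : 0 < Fintype.card τ := by omega
        obtain ⟨t⟩ := Fintype.card_pos_iff.1 this
        obtain ⟨A', μ', x', hst'⟩ := hst.step (t := t) (by simp) (by omega) hyA (by simp)
        refine ⟨insert t ∅, A', μ', x', ?_, ?_, hst'⟩
        · rw [Finset.card_insert_of_notMem (by simp), hc]
        · intro _
          simpa using connSet_singleton t
  obtain ⟨U, A, μ, x, hc, _, hst⟩ := key n le_rfl
  have hU : U = Finset.univ := (Finset.card_eq_iff_eq_univ U).1 hc
  subst hU
  refine ⟨μ, fun m => hst.conn m (Finset.mem_univ _), ?_, ?_⟩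
  · intro m m' h
    exact hst.disj m (Finset.mem_univ _) m' (Finset.mem_univ _) h
  · intro m m' h
    exact hst.adj m (Finset.mem_univ _) m' (Finset.mem_univ _) h

end sweep


theorem reflAdj_width {α β : Type} [Finite α] (H : SimpleGraph β) (B : β → Set α) (w : ℕ)
    (h : ∀ b, (B b).ncard ≤ w) : DeconWidthLE H B (2 * w) := by
  intro a b _
  have := Set.ncard_union_le (B a) (B b)
  have := h a
  have := h b
  omega

theorem decon_of_minor {α β : Type} [Finite α] {M : SimpleGraph α} {G : SimpleGraph β}
    {μ : α → Set β} (h : IsMinorMap M G μ) :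
    IsDeconstruction M G (fun v => {t | v ∈ μ t}) ∧ DeconWidthLE G (fun v => {t | v ∈ μ t}) 2 := by
  obtain ⟨h1, h2, h3⟩ := h
  refine ⟨⟨?_, ?_⟩, ?_⟩
  · rintro g g' (rfl | hadj)
    · obtain ⟨v, hv⟩ := (h1 g).nonempty
      exact ⟨v, v, Or.inl rfl, Or.inl hv, Or.inl hv⟩
    · obtain ⟨v, hv, v', hv', hvv⟩ := h3 g g' hadj
      exact ⟨v, v', Or.inr hvv, Or.inl hv, Or.inr hv'⟩
  · intro g
    exact h1 g
  · refine reflAdj_width G _ 1 ?_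
    intro b
    rw [Set.ncard_le_one (Set.toFinite _)]
    intro s hs t ht
    by_contra hne
    exact Set.disjoint_left.mp (h2 s t hne) hs ht

theorem good_seq {V : Type} {G : SimpleGraph V} {n : ℕ} {X : Set V} (h : GoodSet G n X) :
    ∃ (A : ℕ → Set V) (m : ℕ), A 0 = ∅ ∧ (∀ j, A j ⊆ A (j+1)) ∧ (∀ j, (A (j+1) \ A j).Subsingleton) ∧
      (∀ j, (bdry G (A j)).ncard ≤ n) ∧ ∀ j, m ≤ j → A j = X := by
  induction h with
  | empty =>
    refine ⟨fun _ => ∅, 0, rfl, fun _ => le_rfl, fun _ => by simp, fun _ => ?_, fun _ _ => rfl⟩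
    simp [bdry]
  | step X y hX hn ih =>
    obtain ⟨A, m, h0, h1, h2, h3, h4⟩ := ih
    refine ⟨fun j => if j ≤ m then A j else insert y X, m + 1, ?_, ?_, ?_, ?_, ?_⟩
    · simp [h0]
    · intro j
      rcases lt_trichotomy j m with hj | hj | hj
      · simp only [show j ≤ m by omega, show j + 1 ≤ m by omega, if_true]; exact h1 j
      · subst hj; simp [h4 j le_rfl]
      · simp [show ¬ j ≤ m by omega, show ¬ j + 1 ≤ m by omega]
    · intro j
      rcases lt_trichotomy j m with hj | hj | hj
      · simp only [show j ≤ m by omega, show j + 1 ≤ m by omega, if_true]; exact h2 j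
      · subst hj
        simp only [le_refl, if_true, show ¬ j + 1 ≤ j by omega, if_false, h4 j le_rfl]
        rintro a ⟨ha | ha, ha'⟩ b ⟨hb | hb, hb'⟩
        · rw [ha, hb]
        · exact absurd hb hb'
        · exact absurd ha ha'
        · exact absurd ha ha'
      · simp [show ¬ j ≤ m by omega, show ¬ j + 1 ≤ m by omega]
    · intro j
      show (bdry G (if j ≤ m then A j else insert y X)).ncard ≤ n
      split_ifs
      · exact h3 j
      · exact hn
    · intro j hj
      simp [show ¬ j ≤ m by omega]

theorem path_interval {m : ℕ} {X : Set (Fin m)}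
    (hne : X.Nonempty) (hX : ∀ i j k, i < j → j < k → i ∈ X → k ∈ X → j ∈ X) :
    ConnSet (pathGraph m) X := by
  have key : ∀ (d : ℕ) (i k : Fin m), i ∈ X → k ∈ X → i.1 + d = k.1 → RIn (pathGraph m) X i k := by
    intro d
    induction d with
    | zero =>
      intro i k hi hk h
      have : i = k := Fin.ext (by omega)
      subst this
      exact RIn.refl hi
    | succ d ih =>
      intro i k hi hk h
      have hk' := k.2
      have hj : (⟨i.1 + d, by omega⟩ : Fin m) ∈ X := by
        rcases Nat.eq_zero_or_pos d with rfl | hd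
        · exact hi
        · refine hX i _ k ?_ ?_ hi hk
          · rw [Fin.lt_def]; simp; omega
          · rw [Fin.lt_def]; simp; omega
      refine (ih i ⟨i.1 + d, by omega⟩ hi hj rfl).tail ?_ hk
      rw [pathGraph_adj]
      left; simp; omega
  rw [connSet_iff]
  refine ⟨hne, fun a ha b hb => ?_⟩
  rcases le_total a b with hab | hab
  · exact key (b.1 - a.1) a b ha hb (by rw [Fin.le_def] at hab; omega)
  · exact (key (a.1 - b.1) b a hb ha (by rw [Fin.le_def] at hab; omega)).symm

theorem path_decon {V : Type} [Finite V] {G : SimpleGraph V} {n : ℕ} (h : GoodSet G n Set.univ) :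
    ∃ m, 2 ≤ m ∧ ∃ B : Fin m → Set V, IsDeconstruction G (pathGraph m) B ∧
      DeconWidthLE (pathGraph m) B (2 * (n + 1)) := by
  obtain ⟨A, m, h0, h1, h2, h3, h4⟩ := good_seq h
  have hmono : Monotone A := monotone_nat_of_le_succ h1
  have hcov : ∀ g g', reflAdj G g g' → ∃ i < m + 2, (g ∈ A (i+1) \ A i ∪ bdry G (A i)) ∧
      (g' ∈ A (i+1) \ A i ∪ bdry G (A i)) := by
    classical
    intro g g' hgg
    have hex : ∃ j, g ∈ A j ∧ g' ∈ A j := ⟨m, by rw [h4 m le_rfl]; simp⟩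
    obtain ⟨hj, hmin⟩ := And.intro (Nat.find_spec hex) (fun i => Nat.find_min (H := hex) (m := i))
    have hle : Nat.find hex ≤ m := Nat.find_min' hex (by rw [h4 m le_rfl]; simp)
    generalize Nat.find hex = j at *
    rcases j with _ | j
    · rw [h0] at hj; exact absurd hj.1 (by simp)
    · have hn := hmin j (by omega)
      refine ⟨j, by omega, ?_, ?_⟩
      · by_cases hg : g ∈ A j
        · right
          have hg' : g' ∉ A j := fun h => hn ⟨hg, h⟩
          rcases hgg with rfl | hgg
          · exact absurd hg hg'
          · exact ⟨hg, g', hg', hgg⟩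
        · exact Or.inl ⟨hj.1, hg⟩
      · by_cases hg : g' ∈ A j
        · right
          have hg' : g ∉ A j := fun h => hn ⟨h, hg⟩
          rcases hgg with rfl | hgg
          · exact absurd hg hg'
          · exact ⟨hg, g, hg', hgg.symm⟩
        · exact Or.inl ⟨hj.2, hg⟩
  refine ⟨m + 2, by omega, fun i => (A (i.1+1) \ A i.1) ∪ bdry G (A i.1), ⟨?_, ?_⟩, ?_⟩
  · intro g g' hgg
    obtain ⟨i, hi, ha, hb⟩ := hcov g g' hgg
    exact ⟨⟨i, hi⟩, ⟨i, hi⟩, Or.inl rfl, Or.inl ha, Or.inl hb⟩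
  · intro g
    refine path_interval ?_ ?_
    · obtain ⟨i, hi, ha, hb⟩ := hcov g g (Or.inl rfl)
      exact ⟨⟨i, hi⟩, ha⟩
    · intro i j k hij hjk hi hk
      rw [Fin.lt_def] at hij hjk
      have e1 : g ∈ A (i.1 + 1) := by
        rcases hi with hi | hi
        · exact hi.1
        · exact h1 _ hi.1
      have e2 : g ∈ A j.1 := hmono (show i.1 + 1 ≤ j.1 by omega) e1
      have e3 : g ∈ A k.1 := hmono (show j.1 ≤ k.1 by omega) e2
      rcases hk with hk | ⟨_, u, hu, hgu⟩
      · exact absurd e3 hk.2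
      · exact Or.inr ⟨e2, u, fun h => hu (hmono (show j.1 ≤ k.1 by omega) h), hgu⟩
  · refine reflAdj_width _ _ _ ?_
    intro i
    have a := Set.ncard_union_le (A (i.1+1) \ A i.1) (bdry G (A i.1))
    have b := h3 i.1
    have c : (A (i.1+1) \ A i.1).ncard ≤ 1 := Set.ncard_le_one_iff_subsingleton.mpr (h2 i.1)
    show ((A (i.1+1) \ A i.1) ∪ bdry G (A i.1)).ncard ≤ n + 1
    omega

theorem placing_part2 (𝒢 : Set FinGraph) (h : ¬ DeconLE classT 𝒢) : DeconLE 𝒢 classP := by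
  unfold DeconLE at h
  push Not at h
  obtain ⟨T, hT, hT2⟩ := h 2
  have hT' : T.G.IsTree := hT
  refine ⟨2 * (Fintype.card (Fin T.n) + 1), fun G hG => ?_⟩
  rcases tree_minor_or_good (G := G.G) hT' with hg | ⟨μ, hμ⟩
  · obtain ⟨m, hm, B, hB1, hB2⟩ := path_decon hg
    exact ⟨⟨m, pathGraph m⟩, ⟨m, hm, ⟨Iso.refl⟩⟩, B, hB1, hB2⟩
  · exact absurd (decon_of_minor hμ).2 (hT2 G hG _ (decon_of_minor hμ).1)


/-! ### Excluding a path: bounded tree depth -/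

/-- There is a path in `G[A]` with `m+1` vertices starting in `r`. -/
def PathFrom {V : Type} (G : SimpleGraph V) : ℕ → Set V → V → Prop
  | 0, A, r => r ∈ A
  | m + 1, A, r => r ∈ A ∧ ∃ s, G.Adj r s ∧ PathFrom G m (A \ {r}) s

section td
variable {V : Type} {G : SimpleGraph V}

theorem PathFrom.mono {m : ℕ} : ∀ {A B : Set V} {r : V}, A ⊆ B → PathFrom G m A r → PathFrom G m B r := by
  induction m with
  | zero => intro A B r h hp; exact h hp
  | succ m ih =>
    rintro A B r h ⟨hr, s, hs, hp⟩
    exact ⟨h hr, s, hs, ih (Set.sdiff_subset_sdiff_left h) hp⟩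

theorem PathFrom.fn {m : ℕ} : ∀ {A : Set V} {r : V}, PathFrom G m A r →
    ∃ p : ℕ → V, p 0 = r ∧ (∀ i ≤ m, p i ∈ A) ∧ (∀ i < m, G.Adj (p i) (p (i+1))) ∧
      ∀ i ≤ m, ∀ j ≤ m, p i = p j → i = j := by
  induction m with
  | zero =>
    intro A r h
    exact ⟨fun _ => r, rfl, fun _ _ => h, fun i hi => by omega, fun i hi j hj _ => by omega⟩
  | succ m ih =>
    rintro A r ⟨hr, s, hs, hp⟩
    obtain ⟨p, h0, h1, h2, h3⟩ := ih hp
    refine ⟨fun i => Nat.casesOn i r p, rfl, ?_, ?_, ?_⟩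
    · rintro (_ | i) hi
      · exact hr
      · exact (h1 i (by omega)).1
    · rintro (_ | i) hi
      · show G.Adj r (p 0)
        rw [h0]; exact hs
      · exact h2 i (by omega)
    · rintro (_ | i) hi (_ | j) hj hij
      · rfl
      · exact absurd hij.symm (h1 j (by omega)).2
      · exact absurd hij (h1 i (by omega)).2
      · rw [h3 i (by omega) j (by omega) hij]

theorem iter_transfer {f g : V → V} {C : Set V} {ρ : V} (hf : ∀ x ∈ C, f x ∈ C) (hρ : f ρ = ρ)
    (hg : ∀ x ∈ C, x ≠ ρ → g x = f x) {v : V} (k : ℕ) :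
    ∀ u ∈ C, f^[k] u = v → ∃ k' ≤ k, g^[k'] u = v := by
  induction k with
  | zero => intro u hu h; exact ⟨0, le_rfl, h⟩
  | succ k ih =>
    intro u hu h
    by_cases hur : u = ρ
    · refine ⟨0, by omega, ?_⟩
      rw [← h, hur]
      show ρ = _
      rw [Function.iterate_fixed hρ]
    · rw [Function.iterate_succ_apply] at h
      obtain ⟨k', hk', h'⟩ := ih (f u) (hf u hu) h
      refine ⟨k' + 1, by omega, ?_⟩
      rw [Function.iterate_succ_apply, hg u hu hur, h']

theorem comp_eq {X : Set V} {a b : V} (h : RIn G X a b) :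
    {u | RIn G X a u} = {u | RIn G X b u} := by
  ext u
  exact ⟨fun hu => h.symm.trans hu, fun hu => h.trans hu⟩

theorem dfs_tree (m : ℕ) : ∀ (A : Set V) (r : V), ConnSet G A → r ∈ A → ¬ PathFrom G m A r →
    ∃ par : V → V, par r = r ∧ (∀ v ∈ A, par v ∈ A) ∧ (∀ v ∈ A, ∃ k ≤ m, par^[k] v = r) ∧
      ∀ u ∈ A, ∀ v ∈ A, G.Adj u v → (∃ k : ℕ, par^[k] u = v) ∨ (∃ k : ℕ, par^[k] v = u) := by
  classical
  induction m with
  | zero => intro A r _ hr h; exact absurd hr h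
  | succ m ih =>
    intro A r hA hr hp
    have hC : ∀ C : Set V, ∃ (ρ : V) (par : V → V), (∃ v ∈ A \ {r}, C = {u | RIn G (A \ {r}) v u}) →
        ρ ∈ C ∧ par ρ = ρ ∧ (∀ v ∈ C, par v ∈ C) ∧ (∀ v ∈ C, ∃ k ≤ m, par^[k] v = ρ) ∧
      ∀ u ∈ C, ∀ v ∈ C, G.Adj u v → (∃ k : ℕ, par^[k] u = v) ∨ (∃ k : ℕ, par^[k] v = u) := by
      intro C
      by_cases hC : ∃ v ∈ A \ {r}, C = {u | RIn G (A \ {r}) v u}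
      · obtain ⟨v, hv, rfl⟩ := hC
        have hsub : {u | RIn G (A \ {r}) v u} ⊆ A \ {r} := fun u hu => hu.right
        obtain ⟨u, huA, huC, w, hwA, hwC, huw⟩ := hA.exists_adj (X := {u | RIn G (A \ {r}) v u})
          ⟨v, hv.1, RIn.refl hv⟩ (fun h => (hsub (h hr)).2 rfl)
        have hwr : w = r := by
          by_contra hne
          exact hwC (RIn.tail huC huw ⟨hwA, hne⟩)
        subst hwr
        obtain ⟨par, h⟩ := ih _ u (connSet_comp hv) huC
          (fun hh => hp ⟨hr, u, huw.symm, hh.mono hsub⟩)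
        exact ⟨u, par, fun _ => ⟨huC, h⟩⟩
      · exact ⟨r, id, fun h => absurd h hC⟩
    choose ρ P hP using hC
    let comp : V → Set V := fun v => {u | RIn G (A \ {r}) v u}
    let par : V → V := fun v => if v ∈ A \ {r} then (if v = ρ (comp v) then r else P (comp v) v) else r
    have hparr : par r = r := by simp [par]
    have hroot : ∀ v ∈ A \ {r}, par (ρ (comp v)) = r := by
      intro v hv
      have h1 := (hP (comp v) ⟨v, hv, rfl⟩).1
      have h2 : comp (ρ (comp v)) = comp v := (comp_eq h1).symm
      have h3 : ρ (comp v) ∈ A \ {r} := RIn.right h1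
      simp only [par, h3, if_true, h2]
    have hag : ∀ v ∈ A \ {r}, ∀ x ∈ comp v, x ≠ ρ (comp v) → par x = P (comp v) x := by
      intro v hv x hx hxr
      have h2 : comp x = comp v := (comp_eq hx).symm
      have h3 : x ∈ A \ {r} := RIn.right hx
      simp only [par, h3, if_true, h2, hxr, if_false]
    have htr : ∀ v ∈ A \ {r}, ∀ k, ∀ u ∈ comp v, ∀ w, (P (comp v))^[k] u = w → ∃ k' ≤ k, par^[k'] u = w := by
      intro v hv k u hu w hw
      obtain ⟨h1, h2, h3, _⟩ := hP (comp v) ⟨v, hv, rfl⟩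
      exact iter_transfer h3 h2 (hag v hv) k u hu hw
    have hreach : ∀ v ∈ A, ∃ k ≤ m + 1, par^[k] v = r := by
      intro v hv
      by_cases hvr : v = r
      · exact ⟨0, by omega, hvr⟩
      · have hv' : v ∈ A \ {r} := ⟨hv, hvr⟩
        obtain ⟨h1, h2, h3, h4, _⟩ := hP (comp v) ⟨v, hv', rfl⟩
        obtain ⟨k, hk, h⟩ := h4 v (RIn.refl hv')
        obtain ⟨k', hk', h'⟩ := htr v hv' k v (RIn.refl hv') _ h
        refine ⟨k' + 1, by omega, ?_⟩
        rw [Function.iterate_succ_apply', h', hroot v hv']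
    refine ⟨par, hparr, ?_, hreach, ?_⟩
    · intro v hv
      by_cases hvr : v ∈ A \ {r}
      · obtain ⟨h1, h2, h3, h4, _⟩ := hP (comp v) ⟨v, hvr, rfl⟩
        simp only [par, hvr, if_true]
        split_ifs
        · exact hr
        · exact (RIn.right (h3 v (RIn.refl hvr))).1
      · simp only [par, hvr, if_false]; exact hr
    · intro u hu v hv huv
      by_cases hur : u = r
      · subst hur
        obtain ⟨k, _, h⟩ := hreach v hv
        exact Or.inr ⟨k, h⟩
      by_cases hvr : v = r
      · subst hvr
        obtain ⟨k, _, h⟩ := hreach u hu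
        exact Or.inl ⟨k, h⟩
      have hu' : u ∈ A \ {r} := ⟨hu, hur⟩
      have hv' : v ∈ A \ {r} := ⟨hv, hvr⟩
      obtain ⟨h1, h2, h3, h4, h5⟩ := hP (comp u) ⟨u, hu', rfl⟩
      have huc : u ∈ comp u := RIn.refl hu'
      have hvc : v ∈ comp u := RIn.adj hu' hv' huv
      rcases h5 u huc v hvc huv with ⟨k, hk⟩ | ⟨k, hk⟩
      · obtain ⟨k', _, h⟩ := htr u hu' k u huc v hk
        exact Or.inl ⟨k', h⟩
      · obtain ⟨k', _, h⟩ := htr u hu' k v hvc u hk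
        exact Or.inr ⟨k', h⟩

theorem treeDepth_of_noPath (m : ℕ) (h : ∀ r, ¬ PathFrom G m Set.univ r) : TreeDepthLE G m := by
  classical
  have hC : ∀ C : Set V, ∃ (ρ : V → V) (par : V → V), (∃ v, C = {u | RIn G Set.univ v u}) →
      ∃ ρ, par ρ = ρ ∧ (∀ v ∈ C, par v ∈ C) ∧ (∀ v ∈ C, ∃ k ≤ m, par^[k] v = ρ) ∧
      ∀ u ∈ C, ∀ v ∈ C, G.Adj u v → (∃ k : ℕ, par^[k] u = v) ∨ (∃ k : ℕ, par^[k] v = u) := by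
    intro C
    by_cases hC : ∃ v, C = {u | RIn G Set.univ v u}
    · obtain ⟨v, rfl⟩ := hC
      obtain ⟨par, hh⟩ := dfs_tree (G := G) m _ v (connSet_comp (Set.mem_univ v)) (RIn.refl (Set.mem_univ v))
        (fun hh => h v (hh.mono (Set.subset_univ _)))
      exact ⟨id, par, fun _ => ⟨v, hh⟩⟩
    · exact ⟨id, id, fun h => absurd h hC⟩
  choose _ P hP using hC
  let comp : V → Set V := fun v => {u | RIn G Set.univ v u}
  let par : V → V := fun v => P (comp v) v
  have hself : ∀ v, v ∈ comp v := fun v => RIn.refl (Set.mem_univ v)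
  have hit : ∀ v u, u ∈ comp v → ∀ k, par^[k] u = (P (comp v))^[k] u := by
    intro v u hu k
    have : par^[k] u = (P (comp v))^[k] u ∧ (P (comp v))^[k] u ∈ comp v := by
      obtain ⟨ρ, h2, h3, _⟩ := hP (comp v) ⟨v, rfl⟩
      induction k with
      | zero => exact ⟨rfl, hu⟩
      | succ k ih =>
        rw [Function.iterate_succ_apply', Function.iterate_succ_apply', ih.1]
        refine ⟨?_, h3 _ ih.2⟩
        have : comp ((P (comp v))^[k] u) = comp v := (comp_eq ih.2).symm
        simp only [par, this]
    exact this.1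
  refine ⟨par, ?_, ?_⟩
  · intro v
    obtain ⟨ρ, h2, h3, h4, h5⟩ := hP (comp v) ⟨v, rfl⟩
    obtain ⟨k, hk, hkk⟩ := h4 v (hself v)
    have e : ∀ j, k ≤ j → par^[j] v = ρ := by
      intro j hj
      rw [hit v v (hself v), show j = (j - k) + k by omega, Function.iterate_add_apply, hkk,
        Function.iterate_fixed h2]
    rw [← Function.iterate_succ_apply' par, e _ hk, e _ (by omega)]
  · intro u v huv
    obtain ⟨ρ, h2, h3, h4, h5⟩ := hP (comp u) ⟨u, rfl⟩
    have hv : v ∈ comp u := RIn.adj (Set.mem_univ u) (Set.mem_univ v) huv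
    rcases h5 u (hself u) v hv huv with ⟨k, hk⟩ | ⟨k, hk⟩
    · exact Or.inl ⟨k, by rw [hit u u (hself u), hk]⟩
    · exact Or.inr ⟨k, by rw [hit u v hv, hk]⟩

end td

theorem placing_part3 (𝒢 : Set FinGraph) (h : ¬ DeconLE classP 𝒢) : HasBoundedTreeDepth 𝒢 := by
  unfold DeconLE at h
  push Not at h
  obtain ⟨T, ⟨m, hm, ⟨e⟩⟩, hT2⟩ := h 2
  refine ⟨m - 1, fun G hG => treeDepth_of_noPath _ fun r hr => ?_⟩
  obtain ⟨p, h0, h1, h2, h3⟩ := hr.fn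
  have hμ : IsMinorMap T.G G.G (fun t => {p (e t).1}) := by
    refine ⟨fun t => connSet_singleton _, ?_, ?_⟩
    · intro s t hst
      rw [Set.disjoint_singleton]
      intro hh
      have a := (e s).2
      have b := (e t).2
      exact hst (e.injective (Fin.ext (h3 _ (by omega) _ (by omega) hh)))
    · intro s t hst
      have := e.map_adj_iff.mpr hst
      rw [pathGraph_adj] at this
      have a := (e s).2
      have b := (e t).2
      refine ⟨_, rfl, _, rfl, ?_⟩
      rcases this with hh | hh
      · rw [← hh]; exact h2 _ (by omega)
      · rw [← hh]; exact (h2 _ (by omega)).symm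
  exact absurd (decon_of_minor hμ).2 (hT2 G hG _ (decon_of_minor hμ).1)


/-! ### Tree decompositions by merging -/

theorem RIn.map {α β : Type} {G : SimpleGraph α} {H : SimpleGraph β} (f : α → β) {X : Set α} {Y : Set β}
    (hf : ∀ a b, G.Adj a b → H.Adj (f a) (f b)) (hXY : ∀ a ∈ X, f a ∈ Y) {a b : α} (h : RIn G X a b) :
    RIn H Y (f a) (f b) := by
  refine RIn.induct (P := fun u => RIn H Y (f a) (f u)) h (RIn.refl (hXY a h.left)) ?_
  intro u v _ hu huv hv
  exact hu.tail (hf _ _ huv) (hXY v hv)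

theorem acyclic_sum {α β : Type} {G : SimpleGraph α} {H : SimpleGraph β} (hG : G.IsAcyclic)
    (hH : H.IsAcyclic) : (G ⊕g H).IsAcyclic := by
  rw [isAcyclic_iff_forall_adj_isBridge] at *
  rintro (u | u) (v | v) huv
  · have := hG (sum_adj_inl.mp huv)
    intro hr
    apply this
    rw [reachable_iff_reflTransGen] at hr
    have key : ∀ z, Relation.ReflTransGen ((G ⊕g H).deleteEdges {s(Sum.inl u, Sum.inl v)}).Adj (Sum.inl u) z →
        ∃ w, z = Sum.inl w ∧ (G.deleteEdges {s(u, v)}).Reachable u w := by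
      intro z hz
      induction hz with
      | refl => exact ⟨u, rfl, Reachable.refl _⟩
      | @tail b c _ hbc ih =>
        obtain ⟨w, rfl, hw⟩ := ih
        rcases c with c | c
        · refine ⟨c, rfl, hw.trans (Adj.reachable ?_)⟩
          simpa using hbc
        · simp at hbc
    obtain ⟨w, hw, hw'⟩ := key _ hr
    cases hw
    exact hw'
  · simp at huv
  · simp at huv
  · have := hH (sum_adj_inr.mp huv)
    intro hr
    apply this
    rw [reachable_iff_reflTransGen] at hr
    have key : ∀ z, Relation.ReflTransGen ((G ⊕g H).deleteEdges {s(Sum.inr u, Sum.inr v)}).Adj (Sum.inr u) z →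
        ∃ w, z = Sum.inr w ∧ (H.deleteEdges {s(u, v)}).Reachable u w := by
      intro z hz
      induction hz with
      | refl => exact ⟨u, rfl, Reachable.refl _⟩
      | @tail b c _ hbc ih =>
        obtain ⟨w, rfl, hw⟩ := ih
        rcases c with c | c
        · simp at hbc
        · refine ⟨c, rfl, hw.trans (Adj.reachable ?_)⟩
          simpa using hbc
    obtain ⟨w, hw, hw'⟩ := key _ hr
    cases hw
    exact hw'

/-- `G[A]` has a rooted tree decomposition with bags of size at most `w` whose root bag contains `W`. -/
def Dec {V : Type} (G : SimpleGraph V) (w : ℕ) (A W : Set V) : Prop :=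
  ∃ (τ : Type) (_ : Finite τ) (T : SimpleGraph τ) (B : τ → Set V) (r : τ), T.IsTree ∧
    (∀ h, B h ⊆ A) ∧ (∀ h, (B h).ncard ≤ w) ∧ W ⊆ B r ∧
    (∀ g ∈ A, ∀ g' ∈ A, reflAdj G g g' → ∃ h, g ∈ B h ∧ g' ∈ B h) ∧
    ∀ g ∈ A, ConnSet T {h | g ∈ B h}

section
variable {V : Type} {G : SimpleGraph V} {w : ℕ}

theorem Dec.single {A W : Set V} (hA : A.ncard ≤ w) (hW : W ⊆ A) : Dec G w A W := by
  refine ⟨Unit, inferInstance, ⊥, fun _ => A, (), IsTree.of_subsingleton, fun _ => le_rfl, fun _ => hA, hW,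
    fun g hg g' hg' _ => ⟨(), hg, hg'⟩, fun g hg => connSet_of_root (a := ()) hg ?_⟩
  intro b hb
  exact RIn.refl hb

theorem Dec.weaken {A W W' : Set V} (h : Dec G w A W) (hW : W' ⊆ W) : Dec G w A W' := by
  obtain ⟨τ, hτ, T, B, r, h1, h2, h3, h4, h5⟩ := h
  exact ⟨τ, hτ, T, B, r, h1, h2, h3, hW.trans h4, h5⟩

theorem Dec.merge {A₁ A₂ W₁ W₂ : Set V} (h₁ : Dec G w A₁ W₁) (h₂ : Dec G w A₂ W₂)
    (hi₁ : A₁ ∩ A₂ ⊆ W₁) (hi₂ : A₁ ∩ A₂ ⊆ W₂)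
    (hadj : ∀ u ∈ A₁, ∀ v ∈ A₂, G.Adj u v → u ∈ A₂ ∨ v ∈ A₁) : Dec G w (A₁ ∪ A₂) W₁ := by
  obtain ⟨τ₁, hτ₁, T₁, B₁, r₁, t₁, s₁, c₁, w₁, e₁, k₁⟩ := h₁
  obtain ⟨τ₂, hτ₂, T₂, B₂, r₂, t₂, s₂, c₂, w₂, e₂, k₂⟩ := h₂
  have hl : ∀ a b, T₁.Adj a b → ((T₁ ⊕g T₂) ⊔ edge (Sum.inl r₁) (Sum.inr r₂)).Adj (Sum.inl a) (Sum.inl b) := by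
    intro a b hab
    exact Or.inl (sum_adj_inl.mpr hab)
  have hr : ∀ a b, T₂.Adj a b → ((T₁ ⊕g T₂) ⊔ edge (Sum.inl r₁) (Sum.inr r₂)).Adj (Sum.inr a) (Sum.inr b) := by
    intro a b hab
    exact Or.inl (sum_adj_inr.mpr hab)
  have hm : ((T₁ ⊕g T₂) ⊔ edge (Sum.inl r₁) (Sum.inr r₂)).Adj (Sum.inl r₁) (Sum.inr r₂) := by
    right
    simp [edge_adj]
  refine ⟨τ₁ ⊕ τ₂, inferInstance, (T₁ ⊕g T₂) ⊔ edge (Sum.inl r₁) (Sum.inr r₂), Sum.elim B₁ B₂, Sum.inl r₁,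
    ⟨?_, ?_⟩, ?_, ?_, w₁, ?_, ?_⟩
  · exact Connected.sum_sup_edge t₁.connected t₂.connected
  · exact IsAcyclic.sup_edge_of_not_reachable (not_reachable_sum_inl_inr _ _)
      (acyclic_sum t₁.isAcyclic t₂.isAcyclic)
  · rintro (h | h)
    · exact (s₁ h).trans Set.subset_union_left
    · exact (s₂ h).trans Set.subset_union_right
  · rintro (h | h)
    · exact c₁ h
    · exact c₂ h
  · have hone : ∀ g ∈ A₁, ∀ g' ∈ A₁, reflAdj G g g' → ∃ h, g ∈ Sum.elim B₁ B₂ h ∧ g' ∈ Sum.elim B₁ B₂ h := by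
      intro g hg g' hg' hh
      obtain ⟨h, hh⟩ := e₁ g hg g' hg' hh
      exact ⟨Sum.inl h, hh⟩
    have htwo : ∀ g ∈ A₂, ∀ g' ∈ A₂, reflAdj G g g' → ∃ h, g ∈ Sum.elim B₁ B₂ h ∧ g' ∈ Sum.elim B₁ B₂ h := by
      intro g hg g' hg' hh
      obtain ⟨h, hh⟩ := e₂ g hg g' hg' hh
      exact ⟨Sum.inr h, hh⟩
    rintro g (hg | hg) g' (hg' | hg') hh
    · exact hone g hg g' hg' hh
    · rcases hh with rfl | hh'
      · exact hone g hg g hg (Or.inl rfl)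
      · rcases hadj g hg g' hg' hh' with h | h
        · exact htwo g h g' hg' (Or.inr hh')
        · exact hone g hg g' h (Or.inr hh')
    · rcases hh with rfl | hh'
      · exact htwo g hg g hg (Or.inl rfl)
      · rcases hadj g' hg' g hg hh'.symm with h | h
        · exact htwo g hg g' h (Or.inr hh')
        · exact hone g h g' hg' (Or.inr hh')
    · exact htwo g hg g' hg' hh
  · intro g hg
    by_cases h1 : g ∈ A₁
    · by_cases h2 : g ∈ A₂
      · refine connSet_of_root (a := Sum.inl r₁) (w₁ (hi₁ ⟨h1, h2⟩)) ?_
        have hr1 : g ∈ B₁ r₁ := w₁ (hi₁ ⟨h1, h2⟩)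
        have hr2 : g ∈ B₂ r₂ := w₂ (hi₂ ⟨h1, h2⟩)
        rintro (b | b) hb
        · exact RIn.map Sum.inl hl (fun a ha => ha) ((k₁ g h1).rin hr1 hb)
        · have := RIn.map (Y := {h | g ∈ Sum.elim B₁ B₂ h}) Sum.inr hr (fun a ha => ha) ((k₂ g h2).rin hr2 hb)
          exact (RIn.adj (X := {h | g ∈ Sum.elim B₁ B₂ h}) hr1 hr2 hm).trans this
      · obtain ⟨a, ha⟩ := (k₁ g h1).nonempty
        refine connSet_of_root (a := Sum.inl a) ha ?_
        rintro (b | b) hb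
        · exact RIn.map Sum.inl hl (fun a ha => ha) ((k₁ g h1).rin ha hb)
        · exact absurd (s₂ b hb) h2
    · have h2 : g ∈ A₂ := hg.resolve_left h1
      obtain ⟨a, ha⟩ := (k₂ g h2).nonempty
      refine connSet_of_root (a := Sum.inr a) ha ?_
      rintro (b | b) hb
      · exact absurd (s₁ b hb) h1
      · exact RIn.map Sum.inr hr (fun a ha => ha) ((k₂ g h2).rin ha hb)

theorem Dec.decon [Finite V] {W : Set V} (h : Dec G w Set.univ W) :
    ∃ H ∈ classT, ∃ B : Fin H.n → Set V, IsDeconstruction G H.G B ∧ DeconWidthLE H.G B (2 * w) := by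
  obtain ⟨τ, hτ, T, B, r, h1, h2, h3, h4, h5, h6⟩ := h
  let e : Fin (Nat.card τ) ≃ τ := (Finite.equivFin τ).symm
  refine ⟨⟨Nat.card τ, T.comap e⟩, ?_, fun i => B (e i), ⟨?_, ?_⟩, ?_⟩
  · show (T.comap e).IsTree
    exact (Iso.comap e T).isTree_iff.mpr h1
  · intro g g' hg
    obtain ⟨t, ht⟩ := h5 g (Set.mem_univ _) g' (Set.mem_univ _) hg
    refine ⟨e.symm t, e.symm t, Or.inl rfl, Or.inl ?_, Or.inl ?_⟩
    · simpa using ht.1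
    · simpa using ht.2
  · intro g
    obtain ⟨t, ht⟩ := (h6 g (Set.mem_univ _)).nonempty
    refine connSet_of_root (a := e.symm t) (by simpa using ht) ?_
    intro b hb
    have := (h6 g (Set.mem_univ _)).rin ht hb
    have := RIn.map (H := T.comap e) (Y := {h | g ∈ B (e h)}) e.symm (by intro a b hab; simpa using hab) (by intro a ha; simpa using ha) this
    simpa using this
  · exact reflAdj_width _ _ _ (fun b => h3 _)
end


theorem dec_of_balanced {V : Type} {G : SimpleGraph V} [Finite V] {K : ℕ} (hK : 1 ≤ K)
    (hbal : ∀ W : Set V, ∃ S : Set V, S.ncard ≤ K ∧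
      ∀ C, ConnSet G C → Disjoint C S → 2 * (W ∩ C).ncard ≤ W.ncard) (n : ℕ) :
    ∀ A W : Set V, A.ncard ≤ n → W ⊆ A → W.ncard ≤ 3 * K → Dec G (4 * K) A W := by
  induction n with
  | zero =>
    intro A W hA hW _
    exact Dec.single (by omega) hW
  | succ n ih =>
    intro A W₀ hA hW₀ hcW₀
    by_cases h4 : A.ncard ≤ 4 * K
    · exact Dec.single h4 hW₀
    obtain ⟨W, hWW, hWA, hWc⟩ := Set.exists_subsuperset_card_eq hW₀ hcW₀ (by omega : 3 * K ≤ A.ncard)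
    refine Dec.weaken (W := W) ?_ hWW
    obtain ⟨S, hSc, hS⟩ := hbal W
    let R := W ∪ (S ∩ A)
    have hSA : (S ∩ A).ncard ≤ K := (Set.ncard_le_ncard Set.inter_subset_left (Set.toFinite _)).trans hSc
    have hR : R.ncard ≤ 4 * K := by
      have := Set.ncard_union_le W (S ∩ A)
      show (W ∪ (S ∩ A)).ncard ≤ _
      omega
    have hRA : R ⊆ A := Set.union_subset hWA Set.inter_subset_right
    let Comps : Set (Set V) := {C | ∃ v ∈ A \ S, C = {u | RIn G (A \ S) v u}}
    have hdecC : ∀ C ∈ Comps, Dec G (4 * K) (C ∪ (S ∩ A)) ((W ∩ C) ∪ (S ∩ A)) := by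
      rintro C ⟨v, hv, rfl⟩
      have hCsub : {u | RIn G (A \ S) v u} ⊆ A \ S := fun u hu => hu.right
      have hbC := hS _ (connSet_comp hv) (Set.disjoint_left.mpr fun u hu => (hCsub hu).2)
      generalize {u | RIn G (A \ S) v u} = C at *
      have hWc' := Set.ncard_union_le (W ∩ C) (S ∩ A)
      refine ih _ _ ?_ ?_ ?_
      · have hsub : C ∪ (S ∩ A) ⊆ A := Set.union_subset (fun u hu => (hCsub hu).1) Set.inter_subset_right
        have hne : C ∪ (S ∩ A) ≠ A := by
          intro he
          have : W ⊆ (W ∩ C) ∪ (S ∩ A) := by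
            intro x hx
            have : x ∈ C ∪ (S ∩ A) := by rw [he]; exact hWA hx
            rcases this with h | h
            · exact Or.inl ⟨hx, h⟩
            · exact Or.inr h
          have := Set.ncard_le_ncard this (Set.toFinite _)
          omega
        have := Set.ncard_lt_ncard (hsub.ssubset_of_ne hne) (Set.toFinite _)
        omega
      · exact Set.union_subset_union Set.inter_subset_right le_rfl
      · omega
    have hall : ∀ F : Set (Set V), F ⊆ Comps → Dec G (4 * K) (R ∪ ⋃ C ∈ F, (C ∪ (S ∩ A))) R := by
      intro F
      refine Set.Finite.induction_on (motive := fun F _ => F ⊆ Comps → Dec G (4 * K) (R ∪ ⋃ C ∈ F, (C ∪ (S ∩ A))) R) F (Set.toFinite F) ?_ ?_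
      · intro _
        simp only [Set.mem_empty_iff_false, Set.iUnion_of_empty, Set.iUnion_empty, Set.union_empty]
        exact Dec.single hR le_rfl
      · intro C F hCF _ hF hsub
        have hC : C ∈ Comps := hsub (Or.inl rfl)
        have hF' : F ⊆ Comps := fun X hX => hsub (Or.inr hX)
        have hd := hF hF'
        have heq : R ∪ ⋃ C' ∈ insert C F, (C' ∪ (S ∩ A)) = (R ∪ ⋃ C' ∈ F, (C' ∪ (S ∩ A))) ∪ (C ∪ (S ∩ A)) := by
          rw [Set.biUnion_insert]
          ext x
          simp only [Set.mem_union]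
          tauto
        rw [heq]
        -- an element of C which lies in the old part lies in W
        have hold : ∀ x ∈ C, x ∈ (R ∪ ⋃ C' ∈ F, (C' ∪ (S ∩ A))) → x ∈ W := by
          intro x hxC hx
          obtain ⟨v, hv, rfl⟩ := hC
          have hxAS : x ∈ A \ S := RIn.right hxC
          rcases hx with (hx | hx) | hx
          · exact hx
          · exact absurd hx.1 hxAS.2
          · simp only [Set.mem_iUnion] at hx
            obtain ⟨C', hC', hx⟩ := hx
            rcases hx with hx | hx
            · obtain ⟨v', hv', rfl⟩ := hF' hC'
              exfalso
              apply hCF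
              rw [comp_eq hxC, ← comp_eq hx]
              exact hC'
            · exact absurd hx.1 hxAS.2
        have holdA : (R ∪ ⋃ C' ∈ F, (C' ∪ (S ∩ A))) ⊆ A := by
          refine Set.union_subset hRA (Set.iUnion₂_subset fun C' hC' => Set.union_subset ?_ Set.inter_subset_right)
          obtain ⟨v', hv', rfl⟩ := hF' hC'
          exact fun u hu => (RIn.right hu).1
        refine hd.merge (hdecC C hC) ?_ ?_ ?_
        · rintro x ⟨hx1, hx2 | hx2⟩
          · exact Or.inl (hold x hx2 hx1)
          · exact Or.inr hx2
        · rintro x ⟨hx1, hx2 | hx2⟩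
          · exact Or.inl ⟨hold x hx2 hx1, hx2⟩
          · exact Or.inr hx2
        · rintro u hu v (hv | hv) huv
          · left
            by_cases huS : u ∈ S
            · exact Or.inr ⟨huS, holdA hu⟩
            · left
              obtain ⟨v', hv', rfl⟩ := hC
              exact RIn.tail hv huv.symm ⟨holdA hu, huS⟩
          · right
            exact Or.inl (Or.inr hv)
    have hd := hall Comps le_rfl
    have heq : R ∪ ⋃ C ∈ Comps, (C ∪ (S ∩ A)) = A := by
      apply Set.Subset.antisymm
      · refine Set.union_subset hRA (Set.iUnion₂_subset fun C' hC' => Set.union_subset ?_ Set.inter_subset_right)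
        obtain ⟨v', hv', rfl⟩ := hC'
        exact fun u hu => (RIn.right hu).1
      · intro x hx
        by_cases hxS : x ∈ S
        · exact Or.inl (Or.inr ⟨hxS, hx⟩)
        · right
          simp only [Set.mem_iUnion]
          exact ⟨_, ⟨x, ⟨hx, hxS⟩, rfl⟩, Or.inl (RIn.refl ⟨hx, hxS⟩)⟩
    rw [heq] at hd
    exact hd.weaken Set.subset_union_left


/-! ### Havens -/

structure IsHaven {V : Type} (G : SimpleGraph V) (K : ℕ) (β : Set V → Set V) : Prop where
  conn : ∀ S : Set V, S.ncard ≤ K → ConnSet G (β S)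
  disj : ∀ S : Set V, S.ncard ≤ K → ∀ x ∈ β S, x ∉ S
  mono : ∀ S S' : Set V, S ⊆ S' → S'.ncard ≤ K → β S' ⊆ β S

/-- `X` meets every haven side of order less than `k`. -/
def Big {V : Type} (β : Set V → Set V) (k : ℕ) (X : Set V) : Prop :=
  ∀ S : Set V, S.ncard < k → (X ∩ β S).Nonempty

section
variable {V : Type} {G : SimpleGraph V} [Finite V]

theorem exists_haven {K : ℕ} {W : Set V} (h : ∀ S : Set V, S.ncard ≤ K →
      ∃ C, ConnSet G C ∧ Disjoint C S ∧ W.ncard < 2 * (W ∩ C).ncard) :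
    ∃ β, IsHaven G K β := by
  have h' : ∀ S : Set V, ∃ b : Set V, S.ncard ≤ K →
      (∃ a ∈ Sᶜ, b = {u | RIn G Sᶜ a u}) ∧ W.ncard < 2 * (W ∩ b).ncard := by
    intro S
    by_cases hS : S.ncard ≤ K
    · obtain ⟨C, hC, hd, hW⟩ := h S hS
      obtain ⟨a, ha⟩ := hC.nonempty
      have hCS : C ⊆ Sᶜ := fun u hu => Set.disjoint_left.mp hd hu
      refine ⟨{u | RIn G Sᶜ a u}, fun _ => ⟨⟨a, hCS ha, rfl⟩, lt_of_lt_of_le hW ?_⟩⟩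
      have : W ∩ C ⊆ W ∩ {u | RIn G Sᶜ a u} :=
        fun u hu => ⟨hu.1, (hC.rin ha hu.2).mono hCS le_rfl⟩
      have := Set.ncard_le_ncard this (Set.toFinite _)
      omega
    · exact ⟨∅, fun h => absurd h hS⟩
  choose β hβ using h'
  refine ⟨β, ?_, ?_, ?_⟩
  · intro S hS
    obtain ⟨⟨a, ha, he⟩, _⟩ := hβ S hS
    rw [he]
    exact connSet_comp ha
  · intro S hS x hx
    obtain ⟨⟨a, ha, he⟩, _⟩ := hβ S hS
    rw [he] at hx
    exact RIn.right hx
  · intro S S' hSS hS'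
    have hS : S.ncard ≤ K := (Set.ncard_le_ncard hSS (Set.toFinite _)).trans hS'
    obtain ⟨⟨a, ha, he⟩, hw⟩ := hβ S hS
    obtain ⟨⟨a', ha', he'⟩, hw'⟩ := hβ S' hS'
    have hne : (β S' ∩ β S).Nonempty := by
      by_contra hne
      rw [Set.not_nonempty_iff_eq_empty] at hne
      have hd : Disjoint (W ∩ β S) (W ∩ β S') := by
        rw [Set.disjoint_left]
        intro x hx hx'
        have : x ∈ β S' ∩ β S := ⟨hx'.2, hx.2⟩
        rw [hne] at this
        exact this
      have h1 := Set.ncard_union_eq hd (Set.toFinite _) (Set.toFinite _)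
      have h2 := Set.ncard_le_ncard (Set.union_subset (Set.inter_subset_left (s := W) (t := β S)) (Set.inter_subset_left (s := W) (t := β S'))) (Set.toFinite _)
      omega
    have hc : ConnSet G (β S') := by rw [he']; exact connSet_comp ha'
    refine hc.subset_of_closed hne ?_
    intro u hu hu2 v hv huv
    rw [he] at hu2 ⊢
    rw [he'] at hv
    exact RIn.tail hu2 huv (fun hvS => (RIn.right hv) (hSS hvS))

theorem haven_next {K k : ℕ} {β : Set V → Set V} (hβ : IsHaven G K β) (hk : 1 ≤ k) {S : Set V}
    (hS : S.ncard + k ≤ K) : ∃ X S₁ : Set V, ConnSet G X ∧ X ⊆ β S ∧ Big β k X ∧ S₁.ncard ≤ k ∧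
      X ∩ β S₁ = ∅ := by
  have hY : ConnSet G (β S) := hβ.conn S (by omega)
  have hbig : Big β (k+1) (β S) := by
    intro S' hS'
    have hc : (S ∪ S').ncard ≤ K := (Set.ncard_union_le _ _).trans (by omega)
    obtain ⟨x, hx⟩ := (hβ.conn _ hc).nonempty
    exact ⟨x, hβ.mono _ _ Set.subset_union_left hc hx, hβ.mono _ _ Set.subset_union_right hc hx⟩
  obtain ⟨y, hy⟩ := hY.nonempty
  have hne : {X : Set V | ConnSet G X ∧ X ⊆ β S ∧ ¬ Big β (k+1) X}.Nonempty := by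
    refine ⟨{y}, connSet_singleton y, by simpa using hy, ?_⟩
    intro hb
    obtain ⟨x, hx, hx'⟩ := hb {y} (by rw [Set.ncard_singleton]; omega)
    exact hβ.disj {y} (by rw [Set.ncard_singleton]; omega) x hx' hx
  obtain ⟨X, ⟨hX1, hX2, hX3⟩, hmax⟩ := Set.exists_max_image _ (fun X : Set V => X.ncard) (Set.toFinite _) hne
  have hX3' := hX3
  unfold Big at hX3
  push Not at hX3
  obtain ⟨S₁, hS₁, hXS₁⟩ := hX3
  refine ⟨X, S₁, hX1, hX2, ?_, by omega, hXS₁⟩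
  have hnsub : ¬ β S ⊆ X := by
    intro hsub
    exact hX3' ((Set.Subset.antisymm hX2 hsub) ▸ hbig)
  obtain ⟨x0, hx0⟩ := hX1.nonempty
  obtain ⟨u, huY, huX, v, hvY, hvX, huv⟩ := hY.exists_adj (X := X) ⟨x0, hX2 hx0, hx0⟩ hnsub
  have hins : Big β (k+1) (insert v X) := by
    by_contra hnb
    have := hmax (insert v X) ⟨hX1.insert_adj huX huv, Set.insert_subset hvY hX2, hnb⟩
    rw [Set.ncard_insert_of_notMem hvX (Set.toFinite _)] at this
    omega
  intro S' hS'
  have hc : (insert v S').ncard ≤ k := (Set.ncard_insert_le _ _).trans (by omega)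
  obtain ⟨z, hz, hz'⟩ := hins (insert v S') (by omega)
  rcases hz with rfl | hz
  · exact absurd (Or.inl rfl) (hβ.disj _ (by omega) z hz')
  · exact ⟨z, hz, hβ.mono _ _ (Set.subset_insert _ _) (by omega) hz'⟩

theorem haven_family {K k : ℕ} {β : Set V → Set V} (hβ : IsHaven G K β) (hk : 1 ≤ k) (i : ℕ)
    (hi : i * k ≤ K) : ∃ (P : ℕ → Set V) (S : Set V), S.ncard ≤ i * k ∧ (∀ j < i, ConnSet G (P j)) ∧
      (∀ j < i, Big β k (P j)) ∧ (∀ j < i, ∀ j' < j, Disjoint (P j) (P j')) ∧ ∀ j < i, P j ∩ β S = ∅ := by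
  induction i with
  | zero => exact ⟨fun _ => ∅, ∅, by simp, by simp, by simp, by simp, by simp⟩
  | succ i ih =>
    have hi' : i * k + k ≤ K := by rw [Nat.succ_mul] at hi; exact hi
    obtain ⟨P, S, hS, h1, h2, h3, h4⟩ := ih (by omega)
    obtain ⟨X, S₁, x1, x2, x3, x4, x5⟩ := haven_next hβ hk (S := S) (by omega)
    have hPi : ∀ j < i, Function.update P i X j = P j := fun j hj => Function.update_of_ne (by omega) _ _
    have hPX : Function.update P i X i = X := Function.update_self _ _ _
    have hu := Set.ncard_union_le S S₁
    have hcard : (S ∪ S₁).ncard ≤ (i + 1) * k := by rw [Nat.succ_mul]; omega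
    refine ⟨Function.update P i X, S ∪ S₁, hcard, ?_, ?_, ?_, ?_⟩
    · intro j hj
      rcases Nat.lt_succ_iff_lt_or_eq.mp hj with hj | rfl
      · rw [hPi j hj]; exact h1 j hj
      · rw [hPX]; exact x1
    · intro j hj
      rcases Nat.lt_succ_iff_lt_or_eq.mp hj with hj | rfl
      · rw [hPi j hj]; exact h2 j hj
      · rw [hPX]; exact x3
    · intro j hj j' hj'
      rcases Nat.lt_succ_iff_lt_or_eq.mp hj with hj | rfl
      · rw [hPi j hj, hPi j' (by omega)]; exact h3 j hj j' hj'
      · rw [hPX, hPi j' hj', Set.disjoint_left]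
        intro x hx hx'
        have : x ∈ P j' ∩ β S := ⟨hx', x2 hx⟩
        rw [h4 j' hj'] at this
        exact this
    · intro j hj
      rw [← Set.subset_empty_iff]
      rintro x ⟨hx, hx'⟩
      rcases Nat.lt_succ_iff_lt_or_eq.mp hj with hj | rfl
      · rw [hPi j hj] at hx
        rw [← h4 j hj]
        exact ⟨hx, hβ.mono _ _ Set.subset_union_left (by omega) hx'⟩
      · rw [hPX] at hx
        rw [← x5]
        exact ⟨hx, hβ.mono _ _ Set.subset_union_right (by omega) hx'⟩

theorem dec_or_linkages (G : SimpleGraph V) (l k : ℕ) (hk : 1 ≤ k) :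
    Dec G (4 * ((l + 1) * k)) Set.univ ∅ ∨
    ∃ (P : Fin l → Set V) (Q : Fin l → Fin l → Fin k → Set V), (∀ i, ConnSet G (P i)) ∧
      (∀ i j, i ≠ j → Disjoint (P i) (P j)) ∧ (∀ i j a, ConnSet G (Q i j a)) ∧
      (∀ i j a, (Q i j a ∩ P i).Nonempty) ∧ (∀ i j a, (Q i j a ∩ P j).Nonempty) ∧
      ∀ i j a b, a ≠ b → Disjoint (Q i j a) (Q i j b) := by
  by_cases hbal : ∀ W : Set V, ∃ S : Set V, S.ncard ≤ (l + 1) * k ∧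
      ∀ C, ConnSet G C → Disjoint C S → 2 * (W ∩ C).ncard ≤ W.ncard
  · left
    exact dec_of_balanced (Nat.mul_pos (by omega) hk) hbal _ _ _ le_rfl (Set.empty_subset _) (by simp)
  · right
    push Not at hbal
    obtain ⟨W, hW⟩ := hbal
    obtain ⟨β, hβ⟩ := exists_haven hW
    obtain ⟨P, S, -, h1, h2, h3, -⟩ := haven_family hβ hk l (Nat.mul_le_mul_right _ (by omega))
    have hkK : k ≤ (l + 1) * k := by nlinarith
    have hQ : ∀ i j : Fin l, ∃ C : Fin k → Set V, (∀ a, ConnSet G (C a)) ∧ (∀ a, (C a ∩ P i).Nonempty) ∧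
        (∀ a, (C a ∩ P j).Nonempty) ∧ ∀ a b, a ≠ b → Disjoint (C a) (C b) := by
      intro i j
      apply menger k _ G rfl
      intro S hS
      by_contra hlt
      push Not at hlt
      obtain ⟨x, hx, hx'⟩ := h2 i i.2 S hlt
      obtain ⟨y, hy, hy'⟩ := h2 j j.2 S hlt
      refine hS x hx y hy ?_
      exact ((hβ.conn S (by omega)).rin hx' hy').mono (fun z hz => hβ.disj S (by omega) z hz) le_rfl
    choose Q q1 q2 q3 q4 using hQ
    refine ⟨fun i => P i, Q, fun i => h1 i i.2, ?_, q1, q2, q3, q4⟩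
    intro i j hij
    rcases lt_or_gt_of_ne (fun h => hij (Fin.ext h) : i.1 ≠ j.1) with h | h
    · exact (h3 j j.2 i h).symm
    · exact h3 i i.2 j h
end


/-! ### Cleaning up the linkages -/

theorem bip_ramsey {α β : Type} [DecidableEq α] [DecidableEq β] (n m : ℕ) (R : α → β → Prop)
    (F : Finset α) (H : Finset β) (hF : 2 ^ (n + m) * (n + m) ≤ F.card)
    (hH : 2 ^ (n + m) * (n + m) ≤ H.card) :
    (∃ (a : Fin n → α) (b : Fin n → β), Function.Injective a ∧ Function.Injective b ∧ ∀ i j, R (a i) (b j)) ∨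
    ∃ F' ⊆ F, ∃ H' ⊆ H, m ≤ F'.card ∧ m ≤ H'.card ∧ ∀ a ∈ F', ∀ b ∈ H', ¬ R a b := by
  classical
  have hle : n + m ≤ F.card := le_trans (Nat.le_mul_of_pos_left _ (by positivity)) hF
  obtain ⟨F₀, hF₀, hF₀c⟩ := Finset.exists_subset_card_eq hle
  obtain ⟨t, ht, hc⟩ := Finset.exists_le_card_fiber_of_mul_le_card_of_maps_to
    (s := H) (t := F₀.powerset) (f := fun h => F₀.filter (fun x => R x h)) (n := n + m)
    (fun h _ => Finset.mem_powerset.mpr (Finset.filter_subset _ _)) ⟨∅, by simp⟩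
    (by rw [Finset.card_powerset, hF₀c]; exact hH)
  rw [Finset.mem_powerset] at ht
  set H' := H.filter (fun h => F₀.filter (fun x => R x h) = t) with hH'
  have hR : ∀ h ∈ H', ∀ x ∈ F₀, R x h ↔ x ∈ t := by
    intro h hh x hx
    rw [hH', Finset.mem_filter] at hh
    rw [← hh.2, Finset.mem_filter]
    exact ⟨fun h => ⟨hx, h⟩, fun h => h.2⟩
  by_cases hn : n ≤ t.card
  · left
    obtain ⟨t', ht', hc'⟩ := Finset.exists_subset_card_eq hn
    obtain ⟨s', hs', hd'⟩ := Finset.exists_subset_card_eq (show n ≤ H'.card by omega)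
    let e := (t'.equivFinOfCardEq hc').symm
    let f := (s'.equivFinOfCardEq hd').symm
    refine ⟨fun i => (e i).1, fun i => (f i).1, fun i j h => e.injective (Subtype.ext h),
      fun i j h => f.injective (Subtype.ext h), fun i j => ?_⟩
    have h1 := ht' (e i).2
    exact (hR _ (hs' (f j).2) _ (ht h1)).mpr h1
  · right
    refine ⟨F₀ \ t, Finset.sdiff_subset.trans hF₀, H', Finset.filter_subset _ _, ?_, by omega, ?_⟩
    · have := Finset.le_card_sdiff t F₀
      omega
    · intro a ha b hb hab
      rw [Finset.mem_sdiff] at ha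
      exact ha.2 ((hR b hb a ha.1).mp hab)

theorem multi_ramsey {ι : Type} [DecidableEq ι] (n : ℕ) (E : Finset (ι × ι)) (hE : ∀ e ∈ E, e.1 ≠ e.2) :
    ∀ m : ℕ, ∃ N : ℕ, ∀ (k : ℕ) (R : ι → ι → Fin k → Fin k → Prop) (L : ι → Finset (Fin k)),
      (∀ p, N ≤ (L p).card) →
      (∃ p q, p ≠ q ∧ ∃ a b : Fin n → Fin k, Function.Injective a ∧ Function.Injective b ∧ ∀ i j, R p q (a i) (b j)) ∨
      ∃ L' : ι → Finset (Fin k), (∀ p, L' p ⊆ L p) ∧ (∀ p, m ≤ (L' p).card) ∧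
        ∀ e ∈ E, ∀ a ∈ L' e.1, ∀ b ∈ L' e.2, ¬ R e.1 e.2 a b := by
  induction E using Finset.induction_on with
  | empty =>
    intro m
    exact ⟨m, fun k R L hL => Or.inr ⟨L, fun p => le_rfl, hL, by simp⟩⟩
  | insert e E he ih =>
    intro m
    obtain ⟨N, hN⟩ := ih (fun e he => hE e (Finset.mem_insert_of_mem he)) (max m (2 ^ (n + m) * (n + m)))
    refine ⟨N, fun k R L hL => ?_⟩
    rcases hN k R L hL with h | ⟨L', h1, h2, h3⟩
    · exact Or.inl h
    obtain ⟨p, q⟩ := e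
    have hpq : p ≠ q := hE (p, q) (Finset.mem_insert_self _ _)
    rcases bip_ramsey n m (R p q) (L' p) (L' q) ((le_max_right _ _).trans (h2 p)) ((le_max_right _ _).trans (h2 q)) with
      ⟨a, b, ha, hb, hab⟩ | ⟨F, hF, H, hH, hFc, hHc, hFH⟩
    · exact Or.inl ⟨p, q, hpq, a, b, ha, hb, hab⟩
    right
    have hL2 : ∀ x, Function.update (Function.update L' p F) q H x ⊆ L' x ∧
        m ≤ (Function.update (Function.update L' p F) q H x).card := by
      intro x
      by_cases hxq : x = q
      · subst hxq
        rw [Function.update_self]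
        exact ⟨hH, hHc⟩
      · rw [Function.update_of_ne hxq]
        by_cases hxp : x = p
        · subst hxp
          rw [Function.update_self]
          exact ⟨hF, hFc⟩
        · rw [Function.update_of_ne hxp]
          exact ⟨le_rfl, (le_max_left _ _).trans (h2 x)⟩
    refine ⟨Function.update (Function.update L' p F) q H, fun x => (hL2 x).1.trans (h1 x), fun x => (hL2 x).2, ?_⟩
    intro e' he' a ha b hb
    rcases Finset.mem_insert.mp he' with rfl | he'
    · simp only [Function.update_self, Function.update_of_ne hpq] at ha hb
      exact hFH a ha b hb
    · exact h3 e' he' a ((hL2 _).1 ha) b ((hL2 _).1 hb)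

theorem decon_of_bramble {V : Type} {G : SimpleGraph V} {n : ℕ} (M : SimpleGraph (Fin n))
    (D : Fin n → Set V) (hc : ∀ i, ConnSet G (D i)) (hi : ∀ i j, i ≠ j → (D i ∩ D j).Nonempty)
    (h2 : ∀ v, {i | v ∈ D i}.ncard ≤ 2) :
    IsDeconstruction M G (fun v => {i | v ∈ D i}) ∧ DeconWidthLE G (fun v => {i | v ∈ D i}) 4 := by
  refine ⟨⟨?_, hc⟩, reflAdj_width G _ 2 h2⟩
  intro i j _
  by_cases hij : i = j
  · subst hij
    obtain ⟨v, hv⟩ := (hc i).nonempty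
    exact ⟨v, v, Or.inl rfl, Or.inl hv, Or.inl hv⟩
  · obtain ⟨v, hv, hv'⟩ := hi i j hij
    exact ⟨v, v, Or.inl rfl, Or.inl hv, Or.inl hv'⟩

theorem ncard_two_of {n : ℕ} {X Y Z : Set (Fin n)} (h : X ⊆ Y ∪ Z) (hY : Y.Subsingleton)
    (hZ : Z.Subsingleton) : X.ncard ≤ 2 := by
  have h1 := Set.ncard_le_ncard h (Set.toFinite _)
  have h2 := Set.ncard_union_le Y Z
  have h3 := Set.ncard_le_one_iff_subsingleton.mpr hY
  have h4 := Set.ncard_le_one_iff_subsingleton.mpr hZ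
  omega

theorem dec_or_clique (n : ℕ) : ∃ t : ℕ, ∀ (V : Type) [Finite V] (G : SimpleGraph V),
    Dec G t Set.univ ∅ ∨ ∃ D : Fin n → Set V, (∀ i, ConnSet G (D i)) ∧
      (∀ i j, i ≠ j → (D i ∩ D j).Nonempty) ∧ ∀ v, {i | v ∈ D i}.ncard ≤ 2 := by
  classical
  obtain ⟨N, hN⟩ := multi_ramsey (ι := Fin n × Fin n) n Finset.univ.offDiag
    (fun e he => (Finset.mem_offDiag.mp he).2.2) 1
  refine ⟨4 * ((n + 1) * (N + 1)), fun V _ G => ?_⟩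
  rcases dec_or_linkages G n (N + 1) (by omega) with h | ⟨P, Q, hP, hPd, hQ, hQ1, hQ2, hQd⟩
  · exact Or.inl h
  right
  have hQd' : ∀ i j a b v, v ∈ Q i j a → v ∈ Q i j b → a = b := by
    intro i j a b v ha hb
    by_contra hne
    exact Set.disjoint_left.mp (hQd i j a b hne) ha hb
  rcases hN (N + 1) (fun p q a b => (Q p.1 p.2 a ∩ Q q.1 q.2 b).Nonempty) (fun _ => Finset.univ)
    (fun _ => by simp) with ⟨p, q, hpq, a, b, ha, hb, hab⟩ | ⟨L, -, hL, hL'⟩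
  · refine ⟨fun i => Q p.1 p.2 (a i) ∪ Q q.1 q.2 (b i), fun i => (hQ _ _ _).union (hQ _ _ _) (hab i i), ?_, ?_⟩
    · intro i j _
      obtain ⟨v, hv, hv'⟩ := hab i j
      exact ⟨v, Or.inl hv, Or.inr hv'⟩
    · intro v
      refine ncard_two_of (Y := {i | v ∈ Q p.1 p.2 (a i)}) (Z := {i | v ∈ Q q.1 q.2 (b i)}) (fun i hi => hi) ?_ ?_
      · intro i hi j hj
        exact ha (hQd' _ _ _ _ v hi hj)
      · intro i hi j hj
        exact hb (hQd' _ _ _ _ v hi hj)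
  · have hc : ∀ p, ∃ c, c ∈ L p := fun p => Finset.card_pos.mp (hL p)
    choose c hc using hc
    refine ⟨fun i => P i ∪ ⋃ j, Q i j (c (i, j)), fun i => (hP i).iUnion (fun j => hQ _ _ _) ?_, ?_, ?_⟩
    · intro j
      rw [Set.inter_comm]
      exact hQ1 _ _ _
    · intro i j _
      obtain ⟨v, hv, hv'⟩ := hQ2 i j (c (i, j))
      exact ⟨v, Or.inr (Set.mem_iUnion.mpr ⟨j, hv⟩), Or.inl hv'⟩
    · intro v
      refine ncard_two_of (Y := {i | v ∈ P i}) (Z := {i | v ∈ ⋃ j, Q i j (c (i, j))}) (fun i hi => hi) ?_ ?_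
      · intro i hi j hj
        by_contra hne
        exact Set.disjoint_left.mp (hPd i j hne) hi hj
      · intro i hi j hj
        obtain ⟨i', hi⟩ := Set.mem_iUnion.mp hi
        obtain ⟨j', hj⟩ := Set.mem_iUnion.mp hj
        by_contra hne
        refine hL' ((i, i'), (j, j')) (Finset.mem_offDiag.mpr ⟨Finset.mem_univ _, Finset.mem_univ _, ?_⟩)
          _ (hc _) _ (hc _) ⟨v, hi, hj⟩
        intro h
        exact hne (congrArg Prod.fst h)

theorem placing_part1 (𝒢 : Set FinGraph) (h : ¬ DeconLE classL 𝒢) : DeconLE 𝒢 classT := by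
  unfold DeconLE at h
  push Not at h
  obtain ⟨M, -, hM⟩ := h 4
  obtain ⟨t, ht⟩ := dec_or_clique M.n
  refine ⟨2 * t, fun G hG => ?_⟩
  rcases ht _ G.G with hd | ⟨D, h1, h2, h3⟩
  · exact hd.decon
  · obtain ⟨e1, e2⟩ := decon_of_bramble M.G D h1 h2 h3
    exact absurd e2 (hM G hG _ e1)

/-- (1) if `ℒ ⋠ 𝒢` then `𝒢 ≼ 𝒯`; (2) if `𝒯 ⋠ 𝒢` then `𝒢 ≼ 𝒫`;
(3) if `𝒫 ⋠ 𝒢` then `𝒢` has bounded tree depth. -/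
theorem placing_G (𝒢 : Set FinGraph) :
    (¬ DeconLE classL 𝒢 → DeconLE 𝒢 classT) ∧
    (¬ DeconLE classT 𝒢 → DeconLE 𝒢 classP) ∧
    (¬ DeconLE classP 𝒢 → HasBoundedTreeDepth 𝒢) :=
  ⟨placing_part1 𝒢, placing_part2 𝒢, placing_part3 𝒢⟩
end
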